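/- Let n ≥ 2 and let K and L be convex bodies in ℝⁿ containing the origin in their interiors. If S_{γ_n,K}(η) = S_{γ_n,L}(η) for every Borel set η ⊆ S^{n-1}, and if γ_n(K) ≥ 1/2 and γ_n(L) ≥ 1/2, then γ_n(K) = γ_n(L). -/

import Mathlib

open MeasureTheory Metric Set Filter
open scoped RealInnerProductSpace Topology Pointwise NNReal ENNReal

noncomputable section

/-- `ℝⁿ` as Euclidean space. -/
abbrev Eu (n : ℕ) := EuclideanSpace ℝ (Fin n)

/-- The Gaussian measure `γₙ(A) = (2π)^{-n/2} ∫_A e^{-|x|²/2} dx`. -/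
def gaussVol (n : ℕ) (A : Set (Eu n)) : ℝ :=
  (Real.sqrt (2 * Real.pi))⁻¹ ^ n * ∫ x in A, Real.exp (-‖x‖ ^ 2 / 2)

/-- A convex body: a compact convex set with nonempty interior. -/
def IsConvexBody {n : ℕ} (K : Set (Eu n)) : Prop :=
  Convex ℝ K ∧ IsCompact K ∧ (interior K).Nonempty

/-- The support function `h_K(v) = max_{y ∈ K} ⟪y, v⟫`. -/
def suppFun {n : ℕ} (K : Set (Eu n)) (v : Eu n) : ℝ :=
  sSup ((fun y => ⟪y, v⟫) '' K)

/-- The Gaussian surface area measure of `K`, as a set function: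
`S_{γₙ,K}(η) = (2π)^{-n/2} ∫_{ν_K⁻¹(η)} e^{-|x|²/2} dH^{n-1}(x)`, where
`ν_K⁻¹(η)` is the set of boundary points of `K` having an outer unit normal in `η`. -/
def gaussSurf (n : ℕ) (K : Set (Eu n)) (η : Set (Eu n)) : ℝ :=
  (Real.sqrt (2 * Real.pi))⁻¹ ^ n *
    ∫ x in {x | x ∈ frontier K ∧ ∃ v ∈ η, ⟪x, v⟫ = suppFun K v},
      Real.exp (-‖x‖ ^ 2 / 2) ∂μH[(n : ℝ) - 1]

open Classical in
/-- (A choice of) Gauss map of `K`: to a boundary point `x` it assigns an outer unit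
normal of `K` at `x` (for a convex body `K`, this is unique for `H^{n-1}`-a.e. `x ∈ ∂K`). -/
def gaussMap {n : ℕ} (K : Set (Eu n)) (x : Eu n) : Eu n :=
  if h : ∃ v : Eu n, ‖v‖ = 1 ∧ ⟪x, v⟫ = suppFun K v then h.choose else 0

/-- The Wulff shape `[g] = {x : x·v ≤ g v for all unit v}`. -/
def wulff {n : ℕ} (g : Eu n → ℝ) : Set (Eu n) :=
  {x | ∀ v : Eu n, ‖v‖ = 1 → ⟪x, v⟫ ≤ g v}

/-- The radial function `ρ_K(u) = max {r : r • u ∈ K}`. -/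
def radialFun {n : ℕ} (K : Set (Eu n)) (u : Eu n) : ℝ :=
  sSup {r : ℝ | r • u ∈ K}

/-- The standard Gaussian distribution function `Φ`. -/
def Phi (x : ℝ) : ℝ :=
  (Real.sqrt (2 * Real.pi))⁻¹ * ∫ t in Iic x, Real.exp (-t ^ 2 / 2)

/-- The inverse `Φ⁻¹` of the standard Gaussian distribution function. -/
def PhiInv : ℝ → ℝ := Function.invFun Phi


/-- The standard Gaussian density. -/
def gphi (x : ℝ) : ℝ := (Real.sqrt (2 * Real.pi))⁻¹ * Real.exp (-x ^ 2 / 2)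

lemma gphi_pos (x : ℝ) : 0 < gphi x := by unfold gphi; positivity

lemma gphi_eq (x : ℝ) : gphi x = ProbabilityTheory.gaussianPDFReal 0 1 x := by
  simp [gphi, ProbabilityTheory.gaussianPDFReal]

lemma gphi_continuous : Continuous gphi := by unfold gphi; fun_prop

lemma gphi_integrable : Integrable gphi := by
  have := ProbabilityTheory.integrable_gaussianPDFReal 0 1
  exact this.congr (ae_of_all _ fun x => (gphi_eq x).symm)

lemma gphi_integral : ∫ x, gphi x = 1 := by
  simp_rw [gphi_eq]
  exact ProbabilityTheory.integral_gaussianPDFReal_eq_one 0 one_ne_zero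

lemma gphi_hasDerivAt (x : ℝ) : HasDerivAt gphi (-x * gphi x) x := by
  unfold gphi
  have h1 : HasDerivAt (fun x : ℝ => -x ^ 2 / 2) (-x) x := by
    exact ((hasDerivAt_pow 2 x).neg.div_const 2).congr_deriv (by simp; ring)
  exact (h1.exp.const_mul (Real.sqrt (2 * Real.pi))⁻¹).congr_deriv (by ring)

lemma gphi_le (x : ℝ) : gphi x ≤ 1 := by
  unfold gphi
  have h1 : Real.exp (-x ^ 2 / 2) ≤ 1 := Real.exp_le_one_iff.2 (by nlinarith [sq_nonneg x])
  have h2 : (Real.sqrt (2 * Real.pi))⁻¹ ≤ 1 := by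
    apply inv_le_one_of_one_le₀
    rw [Real.one_le_sqrt]; nlinarith [Real.pi_gt_three]
  exact mul_le_one₀ h2 (Real.exp_pos _).le h1

lemma gphi_lt {a b : ℝ} (ha : 0 ≤ a) (hab : a < b) : gphi b < gphi a := by
  unfold gphi
  have : -b ^ 2 / 2 < -a ^ 2 / 2 := by nlinarith
  gcongr

lemma Phi_eq (x : ℝ) : Phi x = ∫ t in Iic x, gphi t := by
  unfold Phi gphi; rw [integral_const_mul]

lemma Phi_sub (a b : ℝ) : Phi b - Phi a = ∫ t in a..b, gphi t := by
  rw [Phi_eq, Phi_eq]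
  exact intervalIntegral.integral_Iic_sub_Iic gphi_integrable.integrableOn gphi_integrable.integrableOn

lemma Phi_hasDerivAt (x : ℝ) : HasDerivAt Phi (gphi x) x := by
  have h : HasDerivAt (fun b => Phi 0 + ∫ t in (0:ℝ)..b, gphi t) (gphi x) x := by
    apply HasDerivAt.const_add
    exact intervalIntegral.integral_hasDerivAt_right (gphi_continuous.intervalIntegrable _ _)
      (gphi_continuous.stronglyMeasurableAtFilter _ _) gphi_continuous.continuousAt
  convert h using 1
  ext b; rw [← Phi_sub]; ring

lemma Phi_continuous : Continuous Phi :=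
  continuous_iff_continuousAt.2 fun x => (Phi_hasDerivAt x).continuousAt

lemma Phi_strictMono : StrictMono Phi :=
  strictMono_of_hasDerivAt_pos Phi_hasDerivAt gphi_pos

lemma Phi_tendsto_top : Tendsto Phi atTop (𝓝 1) := by
  have := tendsto_setIntegral_of_monotone (μ := volume) (f := gphi) (s := fun x : ℝ => Iic x)
    (fun _ => measurableSet_Iic) (fun a b h => Iic_subset_Iic.2 h)
    (gphi_integrable.integrableOn)
  rw [iUnion_Iic, setIntegral_univ, gphi_integral] at this
  refine this.congr fun x => (Phi_eq x).symm

lemma Phi_tendsto_bot : Tendsto Phi atBot (𝓝 0) := by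
  have h : ∀ x, Phi (-x) = 1 - Phi x := by
    intro x
    rw [Phi_eq, Phi_eq, ← gphi_integral, ← integral_add_compl (measurableSet_Iic (a := x)) gphi_integrable,
      compl_Iic, ← integral_comp_neg_Ioi]
    have : ∀ t, gphi (-t) = gphi t := fun t => by simp [gphi]
    simp [this]
  have h2 : Tendsto (fun x => 1 - Phi (-x)) atBot (𝓝 (1 - 1)) :=
    (Phi_tendsto_top.comp tendsto_neg_atBot_atTop).const_sub 1
  rw [sub_self] at h2
  refine h2.congr fun x => ?_
  have := h (-x); rw [neg_neg] at this; exact this.symm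

lemma Phi_pos (x : ℝ) : 0 < Phi x := by
  have h1 : Phi (x - 1) < Phi x := Phi_strictMono (by linarith)
  have h2 : 0 ≤ Phi (x-1) := le_of_tendsto Phi_tendsto_bot
    (eventually_atBot.2 ⟨x-1, fun y hy => Phi_strictMono.monotone hy⟩)
  linarith

lemma Phi_lt_one (x : ℝ) : Phi x < 1 := by
  have h1 : Phi x < Phi (x+1) := Phi_strictMono (by linarith)
  have h2 : Phi (x+1) ≤ 1 := ge_of_tendsto Phi_tendsto_top
    (eventually_atTop.2 ⟨x+1, fun y hy => Phi_strictMono.monotone hy⟩)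
  linarith

lemma PhiInv_Phi (x : ℝ) : PhiInv (Phi x) = x :=
  Function.leftInverse_invFun Phi_strictMono.injective x

lemma exists_Phi_eq {p : ℝ} (h0 : 0 < p) (h1 : p < 1) : ∃ x, Phi x = p := by
  obtain ⟨a, ha⟩ := (Phi_tendsto_bot.eventually (gt_mem_nhds h0)).exists
  obtain ⟨b, hb⟩ := (Phi_tendsto_top.eventually (lt_mem_nhds h1)).exists
  exact mem_range_of_exists_le_of_exists_ge Phi_continuous ⟨a, ha.le⟩ ⟨b, hb.le⟩

lemma Phi_PhiInv {p : ℝ} (h : p ∈ Ioo (0:ℝ) 1) : Phi (PhiInv p) = p := by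
  obtain ⟨x, rfl⟩ := exists_Phi_eq h.1 h.2
  rw [PhiInv_Phi]

lemma PhiInv_strictMonoOn : StrictMonoOn PhiInv (Ioo 0 1) := by
  intro a ha b hb hab
  rw [← Phi_strictMono.lt_iff_lt, Phi_PhiInv ha, Phi_PhiInv hb]; exact hab

lemma Phi_mem (x : ℝ) : Phi x ∈ Ioo (0:ℝ) 1 := ⟨Phi_pos x, Phi_lt_one x⟩

lemma PhiInv_continuousAt {p : ℝ} (h : p ∈ Ioo (0:ℝ) 1) : ContinuousAt PhiInv p := by
  apply PhiInv_strictMonoOn.continuousAt_of_image_mem_nhds (isOpen_Ioo.mem_nhds h)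
  have : PhiInv '' Ioo 0 1 = univ := by
    ext x; simp only [mem_univ, iff_true]; exact ⟨Phi x, Phi_mem x, PhiInv_Phi x⟩
  rw [this]; exact univ_mem

lemma PhiInv_hasDerivAt {p : ℝ} (h : p ∈ Ioo (0:ℝ) 1) :
    HasDerivAt PhiInv (gphi (PhiInv p))⁻¹ p :=
  HasDerivAt.of_local_left_inverse (PhiInv_continuousAt h) (Phi_hasDerivAt _)
    (gphi_pos _).ne' (by
      filter_upwards [isOpen_Ioo.mem_nhds h] with q hq using Phi_PhiInv hq)

lemma Phi_zero : Phi 0 = 1 / 2 := by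
  have h1 : Phi 0 = ∫ t in Ioi (0:ℝ), gphi t := by
    have := integral_comp_neg_Ioi (0:ℝ) gphi
    rw [neg_zero] at this
    rw [Phi_eq, ← this]
    simp [gphi]
  have h2 := integral_add_compl (measurableSet_Iic (a := (0:ℝ))) gphi_integrable
  rw [gphi_integral, compl_Iic, ← h1, ← Phi_eq] at h2
  linarith

/-- A bounded solution of the transformed heat equation `u_r = r (u_xx - u u_x²)`. -/
structure HeatSol (R P : ℝ) (u ux uxx : ℝ → ℝ → ℝ) : Prop where
  cont : Continuous (fun p : ℝ × ℝ => u p.1 p.2)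
  bd : ∀ r x, |u r x| ≤ R
  bdx : ∀ r x, |ux r x| ≤ P
  dx : ∀ r x, HasDerivAt (u r) (ux r x) x
  dxx : ∀ r x, HasDerivAt (ux r) (uxx r x) x
  dr : ∀ r x, HasDerivAt (fun r => u r x) (r * (uxx r x - u r x * ux r x ^ 2)) r

lemma second_deriv_nonneg_of_isMin {f f' : ℝ → ℝ} {f'' : ℝ} (h1 : ∀ x, HasDerivAt f (f' x) x)
    (h2 : HasDerivAt f' f'' 0) (hmin : IsLocalMin f 0) : 0 ≤ f'' := by
  by_contra! hneg
  have hd : deriv f = f' := funext fun x => (h1 x).deriv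
  have h0 : f' 0 = 0 := hmin.hasDerivAt_eq_zero (h1 0)
  have hmax : IsLocalMax f 0 := by
    apply isLocalMax_of_deriv_deriv_neg
    · rw [hd, h2.deriv]; exact hneg
    · rw [hd, h0]
    · exact (h1 0).continuousAt
  have heq : f =ᶠ[𝓝 0] fun _ => f 0 := by
    filter_upwards [hmin, hmax] with x a b using le_antisymm b a
  have h3 : deriv f =ᶠ[𝓝 0] fun _ => 0 := by
    have := heq.deriv
    filter_upwards [this] with x hx
    rw [hx]; simp
  rw [hd] at h3
  have h4 : deriv f' 0 = 0 := by rw [h3.deriv_eq]; simp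
  rw [h2.deriv] at h4
  linarith

lemma nonpos_deriv_of_min_left {f : ℝ → ℝ} {f' a : ℝ} (ha : 0 < a) (h : HasDerivAt f f' a)
    (hmin : ∀ x, 0 ≤ x → x ≤ a → f a ≤ f x) : f' ≤ 0 := by
  have ht : Tendsto (slope f a) (𝓝[<] a) (𝓝 f') :=
    (hasDerivAt_iff_tendsto_slope.1 h).mono_left (nhdsWithin_mono _ (fun x hx => ne_of_lt hx))
  refine le_of_tendsto ht ?_
  have : Ioo 0 a ∈ 𝓝[<] a := Ioo_mem_nhdsLT ha
  filter_upwards [this] with x hx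
  rw [slope_def_field]
  exact div_nonpos_of_nonneg_of_nonpos (by linarith [hmin x hx.1.le hx.2.le]) (by linarith [hx.2])

/-- The algebra at the minimum point. -/
lemma max_algebra {l m R P E η β r u v w p e1 e2 uxx vxx wxx : ℝ}
    (hl : 0 < l) (hm : 0 < m) (hlm : l + m = 1) (hr0 : 0 ≤ r) (hr1 : r ≤ 1)
    (hu : |u| ≤ R) (hv : |v| ≤ R) (hp : |p| ≤ P) (he1 : |e1| ≤ E) (he2 : |e2| ≤ E)
    (hC : w - l * u - m * v ≤ 0)
    (h2 : 0 ≤ wxx - l * uxx - m * vxx + 4 * η)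
    (hE : 4 * η + R * (2 * P * E + E ^ 2) < β) (hη : 0 ≤ η)
    (hs : r * (wxx - w * p ^ 2) - l * (r * (uxx - u * (p + e1) ^ 2))
      - m * (r * (vxx - v * (p + e2) ^ 2)) + β ≤ 0) : False := by
  have hR : 0 ≤ R := (abs_nonneg _).trans hu
  have hP : 0 ≤ P := (abs_nonneg _).trans hp
  have hE0 : 0 ≤ E := (abs_nonneg _).trans he1
  have key : ∀ u e : ℝ, |u| ≤ R → |e| ≤ E → -(R * (2 * P * E + E ^ 2)) ≤ u * (2 * p * e + e ^ 2) := by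
    intro u e hu he
    have : |u * (2 * p * e + e ^ 2)| ≤ R * (2 * P * E + E ^ 2) := by
      rw [abs_mul]
      have h3 : |2 * p * e + e ^ 2| ≤ 2 * P * E + E ^ 2 := by
        calc |2 * p * e + e ^ 2| ≤ |2 * p * e| + |e ^ 2| := abs_add_le _ _
          _ = 2 * |p| * |e| + |e| ^ 2 := by rw [abs_mul, abs_mul, abs_pow]; norm_num
          _ ≤ _ := by gcongr
      gcongr
    exact (abs_le.1 this).1
  have k1 := key u e1 hu he1
  have k2 := key v e2 hv he2
  set Q := R * (2 * P * E + E ^ 2) with hQ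
  have hQ0 : 0 ≤ Q := by positivity
  have hexp : r * (wxx - w * p ^ 2) - l * (r * (uxx - u * (p + e1) ^ 2))
      - m * (r * (vxx - v * (p + e2) ^ 2)) =
      r * ((wxx - l * uxx - m * vxx) - (w - l * u - m * v) * p ^ 2
        + l * (u * (2 * p * e1 + e1 ^ 2)) + m * (v * (2 * p * e2 + e2 ^ 2))) := by ring
  have h5 : -(4 * η) - Q ≤ (wxx - l * uxx - m * vxx) - (w - l * u - m * v) * p ^ 2
        + l * (u * (2 * p * e1 + e1 ^ 2)) + m * (v * (2 * p * e2 + e2 ^ 2)) := by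
    have a1 : l * (-Q) ≤ l * (u * (2 * p * e1 + e1 ^ 2)) := by gcongr
    have a2 : m * (-Q) ≤ m * (v * (2 * p * e2 + e2 ^ 2)) := by gcongr
    have a3 : 0 ≤ -(w - l * u - m * v) * p ^ 2 := mul_nonneg (by linarith) (sq_nonneg _)
    have a4 : l * (-Q) + m * (-Q) = -Q := by rw [← add_mul, hlm]; ring
    linarith
  rw [hexp] at hs
  have h6 := mul_le_mul_of_nonneg_left h5 hr0
  have h7 : r * (4 * η + Q) ≤ 1 * (4 * η + Q) := by gcongr
  nlinarith

set_option maxHeartbeats 1000000 in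
theorem max_principle {l m R P : ℝ} (hl : 0 < l) (hm : 0 < m) (hlm : l + m = 1)
    {u ux uxx v vx vxx w wx wxx : ℝ → ℝ → ℝ}
    (hu : HeatSol R P u ux uxx) (hv : HeatSol R P v vx vxx) (hw : HeatSol R P w wx wxx)
    (h0 : ∀ x y, l * u 0 x + m * v 0 y ≤ w 0 (l * x + m * y)) (x y : ℝ) :
    l * u 1 x + m * v 1 y ≤ w 1 (l * x + m * y) := by
  by_contra! hneg
  have hR : 0 ≤ R := (abs_nonneg _).trans (hu.bd 0 0)
  have hP : 0 ≤ P := (abs_nonneg _).trans (hu.bdx 0 0)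
  set C : ℝ → ℝ → ℝ → ℝ := fun r x y => w r (l * x + m * y) - l * u r x - m * v r y with hCdef
  have hC1 : C 1 x y < 0 := by simp only [hCdef]; linarith
  have hCb : ∀ r x y, -(2 * R) ≤ C r x y := by
    intro r x y
    have a1 := (abs_le.1 (hw.bd r (l * x + m * y))).1
    have a2 := (abs_le.1 (hu.bd r x)).2
    have a3 := (abs_le.1 (hv.bd r y)).2
    have b1 : l * u r x ≤ l * R := by gcongr
    have b2 : m * v r y ≤ m * R := by gcongr
    have : l * R + m * R = R := by rw [← add_mul, hlm, one_mul]
    simp only [hCdef]; linarith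
  set β := -(C 1 x y) / 2 with hβ
  have hβ0 : 0 < β := by rw [hβ]; linarith
  -- choose η
  set k := 2 * (1 / l + 1 / m) with hk
  have hk0 : 0 < k := by positivity
  have hη : ∃ η : ℝ, 0 < η ∧ η * (x ^ 2 + y ^ 2) < β ∧
      4 * η + R * (2 * P * (k * Real.sqrt (η * (2 * R))) + (k * Real.sqrt (η * (2 * R))) ^ 2) < β := by
    have t1 : Tendsto (fun η : ℝ => η * (x ^ 2 + y ^ 2)) (𝓝[>] 0) (𝓝 0) := by
      have : Continuous (fun η : ℝ => η * (x ^ 2 + y ^ 2)) := by fun_prop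
      simpa using (this.tendsto 0).mono_left nhdsWithin_le_nhds
    have t2 : Tendsto (fun η : ℝ => 4 * η + R * (2 * P * (k * Real.sqrt (η * (2 * R))) + (k * Real.sqrt (η * (2 * R))) ^ 2)) (𝓝[>] 0) (𝓝 0) := by
      have : Continuous (fun η : ℝ => 4 * η + R * (2 * P * (k * Real.sqrt (η * (2 * R))) + (k * Real.sqrt (η * (2 * R))) ^ 2)) := by fun_prop
      simpa using (this.tendsto 0).mono_left nhdsWithin_le_nhds
    obtain ⟨η, h1, h2, h3⟩ := ((eventually_mem_nhdsWithin (a := (0:ℝ)) (s := Ioi 0)).and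
      ((t1.eventually (gt_mem_nhds hβ0)).and (t2.eventually (gt_mem_nhds hβ0)))).exists
    exact ⟨η, h1, h2, h3⟩
  obtain ⟨η, hη0, hη1, hη2⟩ := hη
  set D : ℝ → ℝ → ℝ → ℝ := fun r x y => C r x y + η * (x ^ 2 + y ^ 2) + β * r with hDdef
  have hD1 : D 1 x y < 0 := by
    simp only [hDdef]; rw [mul_one]
    have : C 1 x y = -2 * β := by rw [hβ]; ring
    linarith
  -- box
  obtain ⟨ρ, hρ, hρ2⟩ : ∃ ρ : ℝ, 0 < ρ ∧ 2 * R < η * ρ ^ 2 := by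
    have hq : 0 < 2 * R / η + 1 := by positivity
    refine ⟨Real.sqrt (2 * R / η + 1), Real.sqrt_pos.2 hq, ?_⟩
    rw [Real.sq_sqrt hq.le, mul_add, mul_div_cancel₀ _ hη0.ne']; linarith
  have hbox : ∀ r x y, 0 ≤ r → D r x y < 0 → x ^ 2 + y ^ 2 < ρ ^ 2 ∧ η * (x ^ 2 + y ^ 2) ≤ 2 * R := by
    intro r x y hr hD
    have h1 := hCb r x y
    have h2 : 0 ≤ β * r := by positivity
    have h3 : η * (x ^ 2 + y ^ 2) ≤ 2 * R := by simp only [hDdef] at hD; linarith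
    refine ⟨?_, h3⟩
    exact lt_of_mul_lt_mul_left (h3.trans_lt hρ2) hη0.le
  have hDcont : Continuous (fun q : ℝ × ℝ × ℝ => D q.1 q.2.1 q.2.2) := by
    simp only [hDdef, hCdef]
    have c1 : Continuous (fun q : ℝ × ℝ × ℝ => w q.1 (l * q.2.1 + m * q.2.2)) :=
      hw.cont.comp (f := fun q : ℝ × ℝ × ℝ => (q.1, l * q.2.1 + m * q.2.2)) (by fun_prop)
    have c2 : Continuous (fun q : ℝ × ℝ × ℝ => u q.1 q.2.1) :=
      hu.cont.comp (f := fun q : ℝ × ℝ × ℝ => (q.1, q.2.1)) (by fun_prop)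
    have c3 : Continuous (fun q : ℝ × ℝ × ℝ => v q.1 q.2.2) :=
      hv.cont.comp (f := fun q : ℝ × ℝ × ℝ => (q.1, q.2.2)) (by fun_prop)
    have c4 : Continuous (fun q : ℝ × ℝ × ℝ => η * (q.2.1 ^ 2 + q.2.2 ^ 2)) := by fun_prop
    have c5 : Continuous (fun q : ℝ × ℝ × ℝ => β * q.1) := by fun_prop
    exact (((c1.sub (continuous_const.mul c2)).sub (continuous_const.mul c3)).add c4).add c5
  have hcomp : IsCompact (Icc (0:ℝ) 1 ×ˢ Icc (-ρ) ρ ×ˢ Icc (-ρ) ρ) :=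
    isCompact_Icc.prod (isCompact_Icc.prod isCompact_Icc)
  have hmemsq : ∀ x y : ℝ, x ^ 2 + y ^ 2 < ρ ^ 2 → x ∈ Ioo (-ρ) ρ ∧ y ∈ Ioo (-ρ) ρ := by
    intro x y h
    constructor
    · exact abs_lt.1 (abs_lt_of_sq_lt_sq (by nlinarith [sq_nonneg y]) hρ.le)
    · exact abs_lt.1 (abs_lt_of_sq_lt_sq (by nlinarith [sq_nonneg x]) hρ.le)
  have hxy := hmemsq x y (hbox 1 x y zero_le_one hD1).1
  have hmem1 : ((1:ℝ), x, y) ∈ (Icc (0:ℝ) 1 ×ˢ Icc (-ρ) ρ ×ˢ Icc (-ρ) ρ) :=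
    ⟨⟨zero_le_one, le_rfl⟩, Ioo_subset_Icc_self hxy.1, Ioo_subset_Icc_self hxy.2⟩
  obtain ⟨⟨r₀, x₀, y₀⟩, hmem, hmin⟩ := hcomp.exists_isMinOn ⟨_, hmem1⟩ hDcont.continuousOn
  obtain ⟨⟨hr0, hr1⟩, hx₀, hy₀⟩ := hmem
  simp only at hr0 hr1 hx₀ hy₀
  have hmin' : ∀ r x y, 0 ≤ r → r ≤ 1 → x ∈ Icc (-ρ) ρ → y ∈ Icc (-ρ) ρ → D r₀ x₀ y₀ ≤ D r x y :=
    fun r x y a b c d => hmin (show (r, x, y) ∈ _ from ⟨⟨a, b⟩, c, d⟩)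
  have hDneg : D r₀ x₀ y₀ < 0 :=
    (hmin' 1 x y zero_le_one le_rfl hmem1.2.1 hmem1.2.2).trans_lt hD1
  obtain ⟨hb1, hb2⟩ := hbox _ _ _ hr0 hDneg
  obtain ⟨hxo, hyo⟩ := hmemsq _ _ hb1
  have hr0' : 0 < r₀ := by
    rcases hr0.eq_or_lt with h | h
    · exfalso
      rw [← h] at hDneg
      have := h0 x₀ y₀
      have h2 : 0 ≤ η * (x₀ ^ 2 + y₀ ^ 2) := by positivity
      simp only [hDdef, hCdef] at hDneg
      linarith
    · exact h
  have hC0 : C r₀ x₀ y₀ ≤ 0 := by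
    have h2 : 0 ≤ η * (x₀ ^ 2 + y₀ ^ 2) := by positivity
    have h3 : 0 ≤ β * r₀ := by positivity
    simp only [hDdef] at hDneg; linarith
  set p := wx r₀ (l * x₀ + m * y₀) with hp
  -- gradient in x
  have gx : l * ux r₀ x₀ = l * p + η * (2 * x₀) := by
    have hd : HasDerivAt (fun x => D r₀ x y₀) (p * l - l * ux r₀ x₀ + η * (2 * x₀)) x₀ := by
      simp only [hDdef, hCdef]
      have d1 : HasDerivAt (fun x => w r₀ (l * x + m * y₀)) (p * l) x₀ := by
        have hi : HasDerivAt (fun x => l * x + m * y₀) l x₀ := by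
          simpa using ((hasDerivAt_id x₀).const_mul l).add_const (m * y₀)
        exact (hw.dx r₀ (l * x₀ + m * y₀)).comp x₀ hi
      have d2 := (hu.dx r₀ x₀).const_mul l
      have d3 : HasDerivAt (fun x : ℝ => η * (x ^ 2 + y₀ ^ 2)) (η * (2 * x₀)) x₀ := by
        have := ((hasDerivAt_pow 2 x₀).add_const (y₀ ^ 2)).const_mul η
        simpa using this
      exact ((((d1.sub d2).sub_const _).add d3).add_const _)
    have hloc : IsLocalMin (fun x => D r₀ x y₀) x₀ := by
      filter_upwards [isOpen_Ioo.mem_nhds hxo] with x hx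
      exact hmin' _ _ _ hr0 hr1 (Ioo_subset_Icc_self hx) hy₀
    have := hloc.hasDerivAt_eq_zero hd
    linarith
  have gy : m * vx r₀ y₀ = m * p + η * (2 * y₀) := by
    have hd : HasDerivAt (fun y => D r₀ x₀ y) (p * m - m * vx r₀ y₀ + η * (2 * y₀)) y₀ := by
      simp only [hDdef, hCdef]
      have d1 : HasDerivAt (fun y => w r₀ (l * x₀ + m * y)) (p * m) y₀ := by
        have hi : HasDerivAt (fun y => l * x₀ + m * y) m y₀ := by
          simpa using ((hasDerivAt_id y₀).const_mul m).const_add (l * x₀)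
        exact (hw.dx r₀ (l * x₀ + m * y₀)).comp y₀ hi
      have d2 := (hv.dx r₀ y₀).const_mul m
      have d3 : HasDerivAt (fun y : ℝ => η * (x₀ ^ 2 + y ^ 2)) (η * (2 * y₀)) y₀ := by
        have := ((hasDerivAt_pow 2 y₀).const_add (x₀ ^ 2)).const_mul η
        simpa using this
      exact ((((d1.sub_const _).sub d2).add d3).add_const _)
    have hloc : IsLocalMin (fun y => D r₀ x₀ y) y₀ := by
      filter_upwards [isOpen_Ioo.mem_nhds hyo] with y hy
      exact hmin' _ _ _ hr0 hr1 hx₀ (Ioo_subset_Icc_self hy)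
    have := hloc.hasDerivAt_eq_zero hd
    linarith
  -- second derivative
  have g2 : 0 ≤ wxx r₀ (l * x₀ + m * y₀) - l * uxx r₀ x₀ - m * vxx r₀ y₀ + 4 * η := by
    have hs : ∀ (a τ : ℝ), HasDerivAt (fun τ : ℝ => a + τ) 1 τ := fun a τ => by
      simpa using (hasDerivAt_id τ).const_add a
    have harg : ∀ τ, l * (x₀ + τ) + m * (y₀ + τ) = (l * x₀ + m * y₀) + τ := by
      intro τ
      have : l * (x₀ + τ) + m * (y₀ + τ) = (l * x₀ + m * y₀) + (l + m) * τ := by ring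
      rw [this, hlm, one_mul]
    refine second_deriv_nonneg_of_isMin (f := fun τ => D r₀ (x₀ + τ) (y₀ + τ))
      (f' := fun τ => wx r₀ ((l * x₀ + m * y₀) + τ) - l * ux r₀ (x₀ + τ) - m * vx r₀ (y₀ + τ)
        + η * (2 * (x₀ + τ) + 2 * (y₀ + τ))) ?_ ?_ ?_
    · intro τ
      simp only [hDdef, hCdef, harg]
      have d1 := (hw.dx r₀ ((l * x₀ + m * y₀) + τ)).comp τ (hs (l * x₀ + m * y₀) τ)
      have d2 := ((hu.dx r₀ (x₀ + τ)).comp τ (hs x₀ τ)).const_mul l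
      have d3 := ((hv.dx r₀ (y₀ + τ)).comp τ (hs y₀ τ)).const_mul m
      have d4 := ((((hasDerivAt_pow 2 (x₀ + τ)).comp τ (hs x₀ τ))).add
        (((hasDerivAt_pow 2 (y₀ + τ)).comp τ (hs y₀ τ)))).const_mul η
      refine ((((d1.sub d2).sub d3).add d4).add_const (β * r₀)).congr_deriv ?_
      simp
    · have d1 := (hw.dxx r₀ ((l * x₀ + m * y₀) + 0)).comp 0 (hs (l * x₀ + m * y₀) 0)
      have d2 := ((hu.dxx r₀ (x₀ + 0)).comp 0 (hs x₀ 0)).const_mul l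
      have d3 := ((hv.dxx r₀ (y₀ + 0)).comp 0 (hs y₀ 0)).const_mul m
      have d4 := (((hs x₀ 0).const_mul 2).add ((hs y₀ 0).const_mul 2)).const_mul η
      refine (((d1.sub d2).sub d3).add d4).congr_deriv ?_
      simp; ring
    · have e1 : ∀ᶠ τ in 𝓝 (0:ℝ), x₀ + τ ∈ Ioo (-ρ) ρ := by
        have : ContinuousAt (fun τ : ℝ => x₀ + τ) 0 := by fun_prop
        exact this.eventually_mem (by simpa using isOpen_Ioo.mem_nhds hxo)
      have e2 : ∀ᶠ τ in 𝓝 (0:ℝ), y₀ + τ ∈ Ioo (-ρ) ρ := by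
        have : ContinuousAt (fun τ : ℝ => y₀ + τ) 0 := by fun_prop
        exact this.eventually_mem (by simpa using isOpen_Ioo.mem_nhds hyo)
      filter_upwards [e1, e2] with τ h1 h2
      have := hmin' _ _ _ hr0 hr1 (Ioo_subset_Icc_self h1) (Ioo_subset_Icc_self h2)
      simpa using this
  -- time derivative
  have hE : ∀ (c z z' : ℝ), 0 < c → 2 / c ≤ k → η * z ^ 2 ≤ 2 * R → |η * (2 * z) / c| ≤ k * Real.sqrt (η * (2 * R)) := by
    intro c z z' hc hck hz
    have h1 : |η * z| ≤ Real.sqrt (η * (2 * R)) := by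
      apply Real.abs_le_sqrt
      calc (η * z) ^ 2 = η * (η * z ^ 2) := by ring
        _ ≤ _ := by gcongr
    have h2 : η * (2 * z) / c = 2 / c * (η * z) := by ring
    rw [h2, abs_mul, abs_of_pos (by positivity : 0 < 2 / c)]
    gcongr
  have kl : 2 / l ≤ k := by
    rw [hk]; have : 0 < 1 / m := by positivity
    have h2 : 2 / l = 2 * (1 / l) := by ring
    linarith
  have km : 2 / m ≤ k := by
    rw [hk]; have : 0 < 1 / l := by positivity
    have h2 : 2 / m = 2 * (1 / m) := by ring
    linarith
  have he1 := hE l x₀ 0 hl kl (by nlinarith [sq_nonneg y₀])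
  have he2 := hE m y₀ 0 hm km (by nlinarith [sq_nonneg x₀])
  have hux : ux r₀ x₀ = p + η * (2 * x₀) / l := by
    rw [← mul_right_inj' hl.ne', gx, mul_add, mul_div_cancel₀ _ hl.ne']
  have hvx : vx r₀ y₀ = p + η * (2 * y₀) / m := by
    rw [← mul_right_inj' hm.ne', gy, mul_add, mul_div_cancel₀ _ hm.ne']
  have gs := nonpos_deriv_of_min_left (f := fun r => D r x₀ y₀) hr0'
    (f' := r₀ * (wxx r₀ (l * x₀ + m * y₀) - w r₀ (l * x₀ + m * y₀) * p ^ 2)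
      - l * (r₀ * (uxx r₀ x₀ - u r₀ x₀ * (p + η * (2 * x₀) / l) ^ 2))
      - m * (r₀ * (vxx r₀ y₀ - v r₀ y₀ * (p + η * (2 * y₀) / m) ^ 2)) + β)
    (by
      simp only [hDdef, hCdef]
      have d1 := hw.dr r₀ (l * x₀ + m * y₀)
      have d2 := (hu.dr r₀ x₀).const_mul l
      have d3 := (hv.dr r₀ y₀).const_mul m
      have d4 := (hasDerivAt_id r₀).const_mul β
      rw [hux] at d2; rw [hvx] at d3
      refine ((((d1.sub d2).sub d3).add_const _).add d4).congr_deriv ?_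
      simp [hp])
    (fun r h1 h2 => hmin' _ _ _ h1 (h2.trans hr1) hx₀ hy₀)
  exact max_algebra hl hm hlm hr0 hr1 (hu.bd r₀ x₀) (hv.bd r₀ y₀) (hw.bdx _ _) he1 he2 hC0 g2 hη2 hη0.le gs

/-- The standard Gaussian probability measure on the line. -/
abbrev gm : Measure ℝ := ProbabilityTheory.gaussianReal 0 1

lemma gm_integral (F : ℝ → ℝ) : ∫ x, F x ∂gm = ∫ x, gphi x * F x := by
  rw [ProbabilityTheory.integral_gaussianReal_eq_integral_smul one_ne_zero]
  simp [gphi_eq]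

lemma gm_integrable_id : Integrable (fun x : ℝ => x) gm := by
  have := (ProbabilityTheory.memLp_id_gaussianReal (μ := 0) (v := 1) 1)
  have h2 : MemLp id 1 gm := by simpa using this
  exact memLp_one_iff_integrable.1 h2

lemma integrable_of_cont_bdd {X : Type*} [TopologicalSpace X] [MeasurableSpace X] [BorelSpace X]
    [SecondCountableTopology X]
    {μ : Measure X} [IsFiniteMeasure μ] {F : X → ℝ} {A : ℝ} (hF : Continuous F) (hA : ∀ x, |F x| ≤ A) :
    Integrable F μ :=
  Integrable.of_bound hF.aestronglyMeasurable A (ae_of_all _ hA)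

lemma integrable_mul_gphi {F : ℝ → ℝ} {A : ℝ} (hF : Continuous F) (hA : ∀ x, |F x| ≤ A) :
    Integrable (fun x => F x * gphi x) :=
  Integrable.bdd_mul (c := A) gphi_integrable hF.aestronglyMeasurable (ae_of_all _ hA)

lemma id_mul_gphi_integrable : Integrable (fun x => x * gphi x) := by
  have h := gm_integrable_id
  rw [gm, ProbabilityTheory.gaussianReal_of_var_ne_zero _ one_ne_zero,
    integrable_withDensity_iff_integrable_smul' (ProbabilityTheory.measurable_gaussianPDF 0 1)
     (ae_of_all _ fun x => by simp [ProbabilityTheory.gaussianPDF])] at h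
  refine h.congr (ae_of_all _ fun x => ?_)
  simp only [gphi_eq, ProbabilityTheory.toReal_gaussianPDF, smul_eq_mul]; ring

lemma stein {F F' : ℝ → ℝ} {A : ℝ} (hF : ∀ x, HasDerivAt F (F' x) x) (hc : Continuous F')
    (hA : ∀ x, |F x| ≤ A) (hA' : ∀ x, |F' x| ≤ A) :
    ∫ x, F x * x ∂gm = ∫ x, F' x ∂gm := by
  have hFc : Continuous F := continuous_iff_continuousAt.2 fun x => (hF x).continuousAt
  have := integral_mul_deriv_eq_deriv_mul_of_integrable (u := F) (v := gphi) (u' := F')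
    (v' := fun x => -x * gphi x) (fun x _ => hF x) (fun x _ => gphi_hasDerivAt x)
    (by
      have h1 : Integrable (fun x => F x * (x * gphi x)) :=
        Integrable.bdd_mul (c := A) id_mul_gphi_integrable hFc.aestronglyMeasurable (ae_of_all _ hA)
      refine h1.neg.congr (ae_of_all _ fun x => ?_)
      simp)
    (integrable_mul_gphi hc hA') (integrable_mul_gphi hFc hA)
  rw [gm_integral, gm_integral]
  have e1 : ∀ x, gphi x * (F x * x) = -(F x * (-x * gphi x)) := fun x => by ring
  simp_rw [e1, integral_neg, this, neg_neg]
  congr 1; ext x; ring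

/-- The heat flow. -/
def hflow (f : ℝ → ℝ) (r x : ℝ) : ℝ := ∫ z, f (x + r * z) ∂gm

lemma hflow_cont {f : ℝ → ℝ} {A : ℝ} (hf : Continuous f) (hA : ∀ x, |f x| ≤ A) :
    Continuous (fun p : ℝ × ℝ => hflow f p.1 p.2) := by
  unfold hflow
  apply continuous_of_dominated (bound := fun _ => A)
  · intro p; exact Continuous.aestronglyMeasurable (by fun_prop)
  · intro p; exact ae_of_all _ fun z => hA _
  · exact integrable_const _
  · exact ae_of_all _ fun z => by fun_prop

lemma hflow_bd {f : ℝ → ℝ} {A : ℝ} (hA : ∀ x, |f x| ≤ A) (r x : ℝ) : |hflow f r x| ≤ A := by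
  have := norm_integral_le_of_norm_le_const (μ := gm) (f := fun z => f (x + r * z)) (C := A)
    (ae_of_all _ fun z => hA _)
  simpa [hflow] using this

lemma hflow_dx {f f' : ℝ → ℝ} {A B : ℝ} (hf : ∀ x, HasDerivAt f (f' x) x) (hc : Continuous f')
    (hA : ∀ x, |f x| ≤ A) (hB : ∀ x, |f' x| ≤ B) (r x : ℝ) :
    HasDerivAt (hflow f r) (hflow f' r x) x := by
  have hfc : Continuous f := continuous_iff_continuousAt.2 fun x => (hf x).continuousAt
  refine (hasDerivAt_integral_of_dominated_loc_of_deriv_le (μ := gm) (s := univ)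
    (F := fun x z => f (x + r * z)) (F' := fun x z => f' (x + r * z)) (bound := fun _ => B)
    univ_mem ?_ ?_ ?_ ?_ ?_ ?_).2
  · exact Eventually.of_forall fun x => Continuous.aestronglyMeasurable (by fun_prop)
  · exact integrable_of_cont_bdd (by fun_prop) (fun z => hA _)
  · exact Continuous.aestronglyMeasurable (by fun_prop)
  · exact ae_of_all _ fun z x _ => hB _
  · exact integrable_const _
  · refine ae_of_all _ fun z x _ => ?_
    exact ((hf (x + r * z)).comp x ((hasDerivAt_id x).add_const (r * z))).congr_deriv (by simp)

lemma hflow_dr {f f' f'' : ℝ → ℝ} {A : ℝ} (hf : ∀ x, HasDerivAt f (f' x) x)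
    (hf' : ∀ x, HasDerivAt f' (f'' x) x) (hc : Continuous f'')
    (hA : ∀ x, |f x| ≤ A) (hB : ∀ x, |f' x| ≤ A) (hC : ∀ x, |f'' x| ≤ A) (r x : ℝ) :
    HasDerivAt (fun r => hflow f r x) (r * hflow f'' r x) r := by
  have hfc : Continuous f := continuous_iff_continuousAt.2 fun x => (hf x).continuousAt
  have hfc' : Continuous f' := continuous_iff_continuousAt.2 fun x => (hf' x).continuousAt
  have hA0 : 0 ≤ A := (abs_nonneg _).trans (hA 0)
  have h := (hasDerivAt_integral_of_dominated_loc_of_deriv_le (μ := gm) (s := univ) (x₀ := r)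
    (F := fun r z => f (x + r * z)) (F' := fun r z => f' (x + r * z) * z) (bound := fun z => A * |z|)
    univ_mem ?_ ?_ ?_ ?_ ?_ ?_).2
  · refine h.congr_deriv ?_
    have e := stein (F := fun z => f' (x + r * z)) (F' := fun z => r * f'' (x + r * z))
      (A := A + |r| * A) ?_ ?_ ?_ ?_
    · rw [e, integral_const_mul]; rfl
    · intro z
      have hi : HasDerivAt (fun z => x + r * z) r z := by
        simpa using ((hasDerivAt_id z).const_mul r).const_add x
      refine ((hf' (x + r * z)).comp z hi).congr_deriv (by ring)
    · fun_prop
    · intro z; have := hB (x + r * z); have : 0 ≤ |r| * A := by positivity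
      linarith
    · intro z; rw [abs_mul]
      have : |r| * |f'' (x + r * z)| ≤ |r| * A := by gcongr; exact hC _
      linarith
  · exact Eventually.of_forall fun x => Continuous.aestronglyMeasurable (by fun_prop)
  · exact integrable_of_cont_bdd (by fun_prop) (fun z => hA _)
  · exact Continuous.aestronglyMeasurable (by fun_prop)
  · refine ae_of_all _ fun z r _ => ?_
    rw [Real.norm_eq_abs, abs_mul]; gcongr; exact hB _
  · exact gm_integrable_id.abs.const_mul A
  · refine ae_of_all _ fun z r _ => ?_
    have hi : HasDerivAt (fun r => x + r * z) z r := by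
      simpa using ((hasDerivAt_id r).mul_const z).const_add x
    exact (hf (x + r * z)).comp r hi

lemma hflow_mem {f : ℝ → ℝ} {a b : ℝ} (hf : Continuous f) (h : ∀ x, f x ∈ Icc a b) (r x : ℝ) :
    hflow f r x ∈ Icc a b := by
  have hIntg : Integrable (fun z => f (x + r * z)) gm := integrable_of_cont_bdd (A := max |a| |b|) (by fun_prop)
    (fun z => abs_le_max_abs_abs (h _).1 (h _).2)
  constructor
  · have := integral_mono (integrable_const a) hIntg (fun z => (h _).1)
    simpa [hflow] using this
  · have := integral_mono hIntg (integrable_const b) (fun z => (h _).2)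
    simpa [hflow] using this

lemma PhiInv_abs_le {R q : ℝ} (h : q ∈ Icc (Phi (-R)) (Phi R)) : q ∈ Ioo (0:ℝ) 1 ∧ |PhiInv q| ≤ R := by
  have hq : q ∈ Ioo (0:ℝ) 1 := ⟨(Phi_pos _).trans_le h.1, h.2.trans_lt (Phi_lt_one _)⟩
  refine ⟨hq, abs_le.2 ⟨?_, ?_⟩⟩
  · rw [← Phi_strictMono.le_iff_le, Phi_PhiInv hq]; exact h.1
  · rw [← Phi_strictMono.le_iff_le, Phi_PhiInv hq]; exact h.2

lemma gphi_anti_abs {R x : ℝ} (h : |x| ≤ R) : gphi R ≤ gphi x := by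
  unfold gphi
  have : x ^ 2 ≤ R ^ 2 := sq_le_sq' (abs_le.1 h).1 (abs_le.1 h).2
  have : -R ^ 2 / 2 ≤ -x ^ 2 / 2 := by linarith
  gcongr

lemma heatSol_exists {U U' U'' : ℝ → ℝ} {R B : ℝ} (hU : ∀ x, HasDerivAt U (U' x) x)
    (hU' : ∀ x, HasDerivAt U' (U'' x) x) (hc : Continuous U'')
    (hR : ∀ x, |U x| ≤ R) (hB : ∀ x, |U' x| ≤ B) (hB2 : ∀ x, |U'' x| ≤ B) :
    ∃ ux uxx, HeatSol R ((1 + B + (B + R * B ^ 2)) / gphi R)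
      (fun r x => PhiInv (hflow (fun x => Phi (U x)) r x)) ux uxx := by
  have hUc : Continuous U := continuous_iff_continuousAt.2 fun x => (hU x).continuousAt
  have hUc' : Continuous U' := continuous_iff_continuousAt.2 fun x => (hU' x).continuousAt
  have hR0 : 0 ≤ R := (abs_nonneg _).trans (hR 0)
  have hB0 : 0 ≤ B := (abs_nonneg _).trans (hB 0)
  set f := fun x => Phi (U x) with hf
  set f1 := fun x => gphi (U x) * U' x with hf1
  set f2 := fun x => (-(U x) * gphi (U x) * U' x) * U' x + gphi (U x) * U'' x with hf2
  set A := 1 + B + (B + R * B ^ 2) with hA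
  have d1 : ∀ x, HasDerivAt f (f1 x) x := fun x => (Phi_hasDerivAt (U x)).comp x (hU x)
  have d2 : ∀ x, HasDerivAt f1 (f2 x) x := fun x =>
    ((gphi_hasDerivAt (U x)).comp x (hU x)).mul (hU' x)
  have fc : Continuous f := Phi_continuous.comp hUc
  have gc : Continuous fun x => gphi (U x) := gphi_continuous.comp hUc
  have f1c : Continuous f1 := gc.mul hUc'
  have f2c : Continuous f2 := by simp only [hf2]; fun_prop
  have hpos : 0 ≤ R * B ^ 2 := by positivity
  have b0 : ∀ x, |f x| ≤ A := fun x => by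
    rw [abs_of_pos (Phi_pos _)]; have := Phi_lt_one (U x); simp only [hA, hf]; linarith
  have gb : ∀ x, |gphi (U x)| ≤ 1 := fun x => by rw [abs_of_pos (gphi_pos _)]; exact gphi_le _
  have b1 : ∀ x, |f1 x| ≤ A := fun x => by
    have : |f1 x| ≤ 1 * B := by
      simp only [hf1]; rw [abs_mul]; exact mul_le_mul (gb x) (hB x) (abs_nonneg _) zero_le_one
    simp only [hA]; linarith
  have b2 : ∀ x, |f2 x| ≤ A := fun x => by
    have h1 : |f2 x| ≤ |U x| * |gphi (U x)| * |U' x| * |U' x| + |gphi (U x)| * |U'' x| := by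
      simp only [hf2]; refine (abs_add_le _ _).trans ?_
      simp only [abs_mul, abs_neg]; rfl
    have h2 : |U x| * |gphi (U x)| * |U' x| * |U' x| + |gphi (U x)| * |U'' x| ≤ R * 1 * B * B + 1 * B := by
      gcongr
      · exact hR x
      · exact gb x
      · exact hB x
      · exact hB x
      · exact gb x
      · exact hB2 x
    simp only [hA]; nlinarith
  have hmem : ∀ r x, hflow f r x ∈ Icc (Phi (-R)) (Phi R) := fun r x => hflow_mem fc
    (fun x => ⟨Phi_strictMono.monotone (abs_le.1 (hR x)).1, Phi_strictMono.monotone (abs_le.1 (hR x)).2⟩) r x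
  set u := fun r x => PhiInv (hflow f r x) with hu
  have hub : ∀ r x, |u r x| ≤ R := fun r x => (PhiInv_abs_le (hmem r x)).2
  have hIoo := fun r x => (PhiInv_abs_le (hmem r x)).1
  have gne : ∀ r x, gphi (u r x) ≠ 0 := fun r x => (gphi_pos _).ne'
  have ddx : ∀ r x, HasDerivAt (u r) (hflow f1 r x / gphi (u r x)) x := fun r x => by
    have := (PhiInv_hasDerivAt (hIoo r x)).comp x (hflow_dx d1 f1c b0 b1 r x)
    refine this.congr_deriv ?_
    rw [div_eq_inv_mul]
  refine ⟨fun r x => hflow f1 r x / gphi (u r x),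
    fun r x => hflow f2 r x / gphi (u r x) + u r x * (hflow f1 r x / gphi (u r x)) ^ 2, ?_, ?_, ?_, ?_, ?_, ?_⟩
  · rw [continuous_iff_continuousAt]
    intro p
    exact ContinuousAt.comp (f := fun p : ℝ × ℝ => hflow f p.1 p.2) (PhiInv_continuousAt (hIoo p.1 p.2)) (hflow_cont fc b0).continuousAt
  · exact hub
  · intro r x
    rw [abs_div, abs_of_pos (gphi_pos _)]
    have hA0 : 0 ≤ A := (abs_nonneg _).trans (b0 0)
    exact div_le_div₀ hA0 (hflow_bd b1 r x) (gphi_pos R) (gphi_anti_abs (hub r x))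
  · exact ddx
  · intro r x
    have e1 := hflow_dx d2 f2c b1 b2 r x
    have e2 := (gphi_hasDerivAt (u r x)).comp x (ddx r x)
    refine (e1.div e2 (gne r x)).congr_deriv ?_
    simp only [Function.comp]
    have := gne r x
    field_simp
    ring
  · intro r x
    have := (PhiInv_hasDerivAt (hIoo r x)).comp r (hflow_dr d1 d2 f2c b0 b1 b2 r x)
    refine this.congr_deriv ?_
    change (gphi (u r x))⁻¹ * _ = r * (_ + u r x * _ - u r x * _)
    ring

lemma hflow_zero (f : ℝ → ℝ) (x : ℝ) : hflow f 0 x = f x := by simp [hflow]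

lemma hflow_one (f : ℝ → ℝ) : hflow f 1 0 = ∫ z, f z ∂gm := by simp [hflow]

/-- Ehrhard's functional inequality on a probability space. -/
def Ehr {X : Type*} [TopologicalSpace X] [MeasurableSpace X] [AddCommGroup X] [Module ℝ X]
    (μ : Measure X) : Prop :=
  ∀ (l m R : ℝ), 0 < l → 0 < m → l + m = 1 → ∀ u v w : X → ℝ, Continuous u → Continuous v →
    Continuous w → (∀ x, |u x| ≤ R) → (∀ x, |v x| ≤ R) → (∀ x, |w x| ≤ R) →
    (∀ x y, l * u x + m * v y ≤ w (l • x + m • y)) →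
    l * PhiInv (∫ x, Phi (u x) ∂μ) + m * PhiInv (∫ x, Phi (v x) ∂μ) ≤ PhiInv (∫ x, Phi (w x) ∂μ)

lemma ehr_smooth {l m R B : ℝ} (hl : 0 < l) (hm : 0 < m) (hlm : l + m = 1)
    {U U' U'' V V' V'' W W' W'' : ℝ → ℝ} (hU : ∀ x, HasDerivAt U (U' x) x)
    (hU' : ∀ x, HasDerivAt U' (U'' x) x) (hUc : Continuous U'')
    (hUR : ∀ x, |U x| ≤ R) (hUB : ∀ x, |U' x| ≤ B) (hUB2 : ∀ x, |U'' x| ≤ B)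
    (hV : ∀ x, HasDerivAt V (V' x) x)
    (hV' : ∀ x, HasDerivAt V' (V'' x) x) (hVc : Continuous V'')
    (hVR : ∀ x, |V x| ≤ R) (hVB : ∀ x, |V' x| ≤ B) (hVB2 : ∀ x, |V'' x| ≤ B)
    (hW : ∀ x, HasDerivAt W (W' x) x)
    (hW' : ∀ x, HasDerivAt W' (W'' x) x) (hWc : Continuous W'')
    (hWR : ∀ x, |W x| ≤ R) (hWB : ∀ x, |W' x| ≤ B) (hWB2 : ∀ x, |W'' x| ≤ B)
    (h0 : ∀ x y, l * U x + m * V y ≤ W (l * x + m * y)) :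
    l * PhiInv (∫ x, Phi (U x) ∂gm) + m * PhiInv (∫ x, Phi (V x) ∂gm) ≤ PhiInv (∫ x, Phi (W x) ∂gm) := by
  obtain ⟨_, _, hu⟩ := heatSol_exists hU hU' hUc hUR hUB hUB2
  obtain ⟨_, _, hv⟩ := heatSol_exists hV hV' hVc hVR hVB hVB2
  obtain ⟨_, _, hw⟩ := heatSol_exists hW hW' hWc hWR hWB hWB2
  have := max_principle hl hm hlm hu hv hw (fun x y => by
    simp only [hflow_zero, PhiInv_Phi]; exact h0 x y) 0 0
  simpa [hflow_one] using this

/-- Box average. -/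
def avg (d : ℝ) (U : ℝ → ℝ) (x : ℝ) : ℝ := ∫ t in (0:ℝ)..1, U (x + d * t)

lemma avg_hasDerivAt {d : ℝ} (hd : d ≠ 0) {U : ℝ → ℝ} (hU : Continuous U) (x : ℝ) :
    HasDerivAt (avg d U) ((U (x + d) - U x) / d) x := by
  have e : avg d U = fun x => d⁻¹ * ((∫ t in (0:ℝ)..(x + d), U t) - ∫ t in (0:ℝ)..x, U t) := by
    ext x
    rw [avg, intervalIntegral.integral_comp_add_mul _ hd, intervalIntegral.integral_interval_sub_left
      (hU.intervalIntegrable _ _) (hU.intervalIntegrable _ _)]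
    simp
  rw [e]
  have F : ∀ y, HasDerivAt (fun y => ∫ t in (0:ℝ)..y, U t) (U y) y := fun y =>
    intervalIntegral.integral_hasDerivAt_right (hU.intervalIntegrable _ _)
      (hU.stronglyMeasurableAtFilter _ _) hU.continuousAt
  have h1 := (F (x + d)).comp x ((hasDerivAt_id x).add_const d)
  refine ((h1.sub (F x)).const_mul d⁻¹).congr_deriv ?_
  simp; ring

lemma avg_cont {U : ℝ → ℝ → ℝ} (hU : Continuous (fun p : ℝ × ℝ => U p.1 p.2)) :
    Continuous (fun p : ℝ × ℝ => avg p.1 (U p.1) p.2) := by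
  unfold avg
  apply intervalIntegral.continuous_parametric_intervalIntegral_of_continuous'
  exact hU.comp (f := fun p : (ℝ × ℝ) × ℝ => (p.1.1, p.1.2 + p.1.1 * p.2)) (by fun_prop)

lemma avg_bd {d R : ℝ} {U : ℝ → ℝ} (hR : ∀ x, |U x| ≤ R) (x : ℝ) : |avg d U x| ≤ R := by
  have := intervalIntegral.norm_integral_le_of_norm_le_const (a := (0:ℝ)) (b := 1) (C := R)
    (f := fun t => U (x + d * t)) (fun t _ => hR _)
  simpa [avg] using this

lemma avg_rel {l m d : ℝ} (hlm : l + m = 1) {U V W : ℝ → ℝ} (hU : Continuous U) (hV : Continuous V)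
    (hW : Continuous W) (h0 : ∀ x y, l * U x + m * V y ≤ W (l * x + m * y)) (x y : ℝ) :
    l * avg d U x + m * avg d V y ≤ avg d W (l * x + m * y) := by
  unfold avg
  rw [← intervalIntegral.integral_const_mul, ← intervalIntegral.integral_const_mul,
    ← intervalIntegral.integral_add (Continuous.intervalIntegrable (by fun_prop) _ _)
      (Continuous.intervalIntegrable (by fun_prop) _ _)]
  apply intervalIntegral.integral_mono_on zero_le_one (Continuous.intervalIntegrable (by fun_prop) _ _)
      (Continuous.intervalIntegrable (by fun_prop) _ _)
  intro t _
  refine (h0 _ _).trans (le_of_eq ?_)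
  congr 1
  have : l * (x + d * t) + m * (y + d * t) = l * x + m * y + (l + m) * (d * t) := by ring
  rw [this, hlm, one_mul]

lemma avg_avg_smooth {d R : ℝ} (hd : 0 < d) {U : ℝ → ℝ} (hU : Continuous U) (hR : ∀ x, |U x| ≤ R) :
    ∃ U' U'' : ℝ → ℝ, (∀ x, HasDerivAt (avg d (avg d U)) (U' x) x) ∧
      (∀ x, HasDerivAt U' (U'' x) x) ∧ Continuous U'' ∧
      (∀ x, |U' x| ≤ 2 * R / d + 4 * R / d ^ 2) ∧ (∀ x, |U'' x| ≤ 2 * R / d + 4 * R / d ^ 2) := by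
  have hR0 : 0 ≤ R := (abs_nonneg _).trans (hR 0)
  have h1 := avg_hasDerivAt hd.ne' hU
  have hc : Continuous (avg d U) := continuous_iff_continuousAt.2 fun x => (h1 x).continuousAt
  have h2 := avg_hasDerivAt hd.ne' hc
  have p1 : 0 ≤ 2 * R / d := by positivity
  have p2 : 0 ≤ 4 * R / d ^ 2 := by positivity
  have sb : ∀ {S : ℝ} {F : ℝ → ℝ}, (∀ x, |F x| ≤ S) → ∀ x, |(F (x + d) - F x) / d| ≤ 2 * S / d := by
    intro S F hF x
    rw [abs_div, abs_of_pos hd]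
    gcongr
    refine (abs_sub _ _).trans ?_
    linarith [hF x, hF (x + d)]
  refine ⟨_, fun x => ((U (x + d + d) - U (x + d)) / d - (U (x + d) - U x) / d) / d, h2, ?_, ?_, ?_, ?_⟩
  · intro x
    have a := (h1 (x + d)).comp x ((hasDerivAt_id x).add_const d)
    exact ((a.sub (h1 x)).div_const d).congr_deriv (by simp)
  · fun_prop
  · intro x; have := sb (avg_bd hR (d := d)) x; linarith
  · intro x
    have := sb (F := fun x => (U (x + d) - U x) / d) (sb hR) x
    have e : 2 * (2 * R / d) / d = 4 * R / d ^ 2 := by field_simp; ring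
    rw [e] at this; linarith

lemma integral_Phi_mem {X : Type*} [TopologicalSpace X] [MeasurableSpace X] [BorelSpace X]
    [SecondCountableTopology X] {μ : Measure X} [IsProbabilityMeasure μ] {u : X → ℝ} {R : ℝ}
    (hu : Continuous u) (hR : ∀ x, |u x| ≤ R) :
    ∫ x, Phi (u x) ∂μ ∈ Icc (Phi (-R)) (Phi R) := by
  have hm : ∀ x, Phi (u x) ∈ Icc (Phi (-R)) (Phi R) := fun x =>
    ⟨Phi_strictMono.monotone (abs_le.1 (hR x)).1, Phi_strictMono.monotone (abs_le.1 (hR x)).2⟩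
  have hIntg : Integrable (fun x => Phi (u x)) μ := integrable_of_cont_bdd (A := 1) (Phi_continuous.comp hu)
    (fun x => by rw [abs_of_pos (Phi_pos _)]; exact (Phi_lt_one _).le)
  constructor
  · have := integral_mono (integrable_const (Phi (-R))) hIntg (fun z => (hm z).1)
    simpa using this
  · have := integral_mono hIntg (integrable_const (Phi R)) (fun z => (hm z).2)
    simpa using this

theorem ehr_one : Ehr gm := by
  intro l m R hl hm hlm u v w hu hv hw hur hvr hwr h0
  have key : ∀ d : ℝ, 0 < d →
      l * PhiInv (∫ x, Phi (avg d (avg d u) x) ∂gm) + m * PhiInv (∫ x, Phi (avg d (avg d v) x) ∂gm)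
       ≤ PhiInv (∫ x, Phi (avg d (avg d w) x) ∂gm) := by
    intro d hd
    have cc : ∀ {u : ℝ → ℝ}, Continuous u → Continuous (avg d u) := fun hu =>
      continuous_iff_continuousAt.2 fun x => (avg_hasDerivAt hd.ne' hu x).continuousAt
    obtain ⟨u1, u2, a1, a2, a3, a4, a5⟩ := avg_avg_smooth hd hu hur
    obtain ⟨v1, v2, b1, b2, b3, b4, b5⟩ := avg_avg_smooth hd hv hvr
    obtain ⟨w1, w2, c1, c2, c3, c4, c5⟩ := avg_avg_smooth hd hw hwr
    exact ehr_smooth hl hm hlm a1 a2 a3 (avg_bd (avg_bd hur)) a4 a5 b1 b2 b3 (avg_bd (avg_bd hvr)) b4 b5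
      c1 c2 c3 (avg_bd (avg_bd hwr)) c4 c5
      (avg_rel hlm (cc hu) (cc hv) (cc hw) (avg_rel hlm hu hv hw h0))
  have lim : ∀ {u : ℝ → ℝ}, Continuous u → (∀ x, |u x| ≤ R) →
      Tendsto (fun d : ℝ => PhiInv (∫ x, Phi (avg d (avg d u) x) ∂gm)) (𝓝[>] 0)
        (𝓝 (PhiInv (∫ x, Phi (u x) ∂gm))) := by
    intro u hu hur
    have hcont : Continuous (fun d : ℝ => ∫ x, Phi (avg d (avg d u) x) ∂gm) := by
      have c1 : Continuous (fun p : ℝ × ℝ => avg p.1 u p.2) :=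
        avg_cont (U := fun _ x => u x) (hu.comp continuous_snd)
      have c2 : Continuous (fun p : ℝ × ℝ => avg p.1 (avg p.1 u) p.2) :=
        avg_cont (U := fun d x => avg d u x) c1
      have c3 := Phi_continuous.comp c2
      apply continuous_of_dominated (bound := fun _ => 1)
      · intro d
        exact (c3.comp (f := fun x : ℝ => (d, x)) (by fun_prop)).aestronglyMeasurable
      · intro d; refine ae_of_all _ fun x => ?_
        rw [Real.norm_eq_abs, abs_of_pos (Phi_pos _)]; exact (Phi_lt_one _).le
      · exact integrable_const _
      · refine ae_of_all _ fun x => ?_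
        exact c3.comp (f := fun d : ℝ => (d, x)) (by fun_prop)
    have h1 := (hcont.tendsto 0).mono_left (nhdsWithin_le_nhds (s := Ioi 0))
    have e0 : ∀ x, avg 0 (avg 0 u) x = u x := fun x => by simp [avg]
    simp only [e0] at h1
    exact (PhiInv_continuousAt (PhiInv_abs_le (integral_Phi_mem hu hur)).1).tendsto.comp h1
  exact le_of_tendsto_of_tendsto (((lim hu hur).const_mul l).add ((lim hv hvr).const_mul m))
    (lim hw hwr) (by filter_upwards [self_mem_nhdsWithin] with d hd using key d hd)

lemma Ehr.prod {X Y : Type*} [TopologicalSpace X] [MeasurableSpace X] [BorelSpace X]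
    [SecondCountableTopology X] [AddCommGroup X] [Module ℝ X]
    [TopologicalSpace Y] [MeasurableSpace Y] [BorelSpace Y]
    [SecondCountableTopology Y] [AddCommGroup Y] [Module ℝ Y]
    {μ : Measure X} {ν : Measure Y} [IsProbabilityMeasure μ] [IsProbabilityMeasure ν]
    (hμ : Ehr μ) (hν : Ehr ν) : Ehr (μ.prod ν) := by
  intro l m R hl hm hlm u v w hu hv hw hur hvr hwr h0
  have hmem : ∀ {u : X × Y → ℝ}, Continuous u → (∀ x, |u x| ≤ R) → ∀ x,
      ∫ y, Phi (u (x, y)) ∂ν ∈ Icc (Phi (-R)) (Phi R) := fun hu hur x =>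
    integral_Phi_mem (hu.comp (by fun_prop)) (fun y => hur (x, y))
  have hc : ∀ {u : X × Y → ℝ}, Continuous u → (∀ x, |u x| ≤ R) →
      Continuous (fun x => PhiInv (∫ y, Phi (u (x, y)) ∂ν)) := by
    intro u hu hur
    have hcont : Continuous (fun x => ∫ y, Phi (u (x, y)) ∂ν) := by
      apply continuous_of_dominated (bound := fun _ => 1)
      · intro x
        exact (Phi_continuous.comp (hu.comp (by fun_prop))).aestronglyMeasurable
      · intro d; refine ae_of_all _ fun x => ?_
        rw [Real.norm_eq_abs, abs_of_pos (Phi_pos _)]; exact (Phi_lt_one _).le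
      · exact integrable_const _
      · exact ae_of_all _ fun y => Phi_continuous.comp (hu.comp (by fun_prop))
    exact continuous_iff_continuousAt.2 fun x =>
      ContinuousAt.comp (f := fun x => ∫ y, Phi (u (x, y)) ∂ν) (g := PhiInv)
        (PhiInv_continuousAt (PhiInv_abs_le (hmem hu hur x)).1) hcont.continuousAt
  have he : ∀ {u : X × Y → ℝ}, Continuous u → (∀ x, |u x| ≤ R) →
      ∫ x, Phi (PhiInv (∫ y, Phi (u (x, y)) ∂ν)) ∂μ = ∫ z, Phi (u z) ∂(μ.prod ν) := by
    intro u hu hur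
    have hIntg : Integrable (fun x => Phi (u x)) (μ.prod ν) :=
      integrable_of_cont_bdd (A := 1) (Phi_continuous.comp hu)
      (fun x => by rw [abs_of_pos (Phi_pos _)]; exact (Phi_lt_one _).le)
    rw [integral_prod _ hIntg]
    congr 1; ext x
    exact Phi_PhiInv (PhiInv_abs_le (hmem hu hur x)).1
  have := hμ l m R hl hm hlm _ _ _ (hc hu hur) (hc hv hvr) (hc hw hwr)
    (fun x => (PhiInv_abs_le (hmem hu hur x)).2) (fun x => (PhiInv_abs_le (hmem hv hvr x)).2)
    (fun x => (PhiInv_abs_le (hmem hw hwr x)).2) (fun x x' =>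
      hν l m R hl hm hlm _ _ _ (hu.comp (by fun_prop)) (hv.comp (by fun_prop)) (hw.comp (by fun_prop))
        (fun y => hur (x, y)) (fun y => hvr (x', y)) (fun y => hwr (l • x + m • x', y))
        (fun y y' => h0 (x, y) (x', y')))
  rwa [he hu hur, he hv hvr, he hw hwr] at this

lemma Ehr.map {X Y : Type*} [TopologicalSpace X] [MeasurableSpace X] [BorelSpace X]
    [AddCommGroup X] [Module ℝ X] [TopologicalSpace Y] [MeasurableSpace Y] [BorelSpace Y]
    [AddCommGroup Y] [Module ℝ Y] {μ : Measure X} (hμ : Ehr μ) (f : X →L[ℝ] Y) :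
    Ehr (μ.map f) := by
  intro l m R hl hm hlm u v w hu hv hw hur hvr hwr h0
  have e : ∀ {u : Y → ℝ}, Continuous u → ∫ y, Phi (u y) ∂(μ.map f) = ∫ x, Phi (u (f x)) ∂μ :=
    fun hu => integral_map f.continuous.measurable.aemeasurable
      (Phi_continuous.comp hu).measurable.aestronglyMeasurable
  rw [e hu, e hv, e hw]
  exact hμ l m R hl hm hlm _ _ _ (hu.comp f.continuous) (hv.comp f.continuous) (hw.comp f.continuous)
    (fun x => hur _) (fun x => hvr _) (fun x => hwr _) (fun x y => by simpa using h0 (f x) (f y))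

lemma ehr_pi (n : ℕ) : Ehr (Measure.pi (fun _ : Fin n => gm)) := by
  induction n with
  | zero =>
    intro l m R hl hm hlm u v w hu hv hw hur hvr hwr h0
    rw [Measure.pi_of_empty _ (fun a => isEmptyElim a)]
    simp only [integral_dirac]
    have := h0 (fun a => isEmptyElim a) (fun a => isEmptyElim a)
    rw [PhiInv_Phi, PhiInv_Phi, PhiInv_Phi]
    convert this using 2
  | succ n ih =>
    have h := (measurePreserving_piFinSuccAbove (fun _ : Fin (n+1) => gm) 0).symm.map_eq
    let f : (ℝ × (Fin n → ℝ)) →L[ℝ] (Fin (n+1) → ℝ) :=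
      ContinuousLinearMap.pi (Fin.cons (ContinuousLinearMap.fst ℝ _ _)
        (fun i => (ContinuousLinearMap.proj i).comp (ContinuousLinearMap.snd ℝ _ _)))
    have hf : ⇑f = (MeasurableEquiv.piFinSuccAbove (fun _ : Fin (n+1) => ℝ) 0).symm := by
      ext p i
      refine Fin.cases ?_ (fun j => ?_) i
      · simp [f, MeasurableEquiv.piFinSuccAbove]
      · simp [f, MeasurableEquiv.piFinSuccAbove]
    rw [← h, ← hf]
    exact (ehr_one.prod ih).map f

/-- Standard Gaussian on Euclidean space. -/
def gE (n : ℕ) : Measure (Eu n) := (Measure.pi (fun _ : Fin n => gm)).map (WithLp.toLp 2)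

lemma ehr_E (n : ℕ) : Ehr (gE n) := 
  (ehr_pi n).map ((PiLp.continuousLinearEquiv 2 ℝ (fun _ : Fin n => ℝ)).symm : (Fin n → ℝ) →L[ℝ] Eu n)

instance (n : ℕ) : IsProbabilityMeasure (gE n) := by
  apply Measure.isProbabilityMeasure_map
  fun_prop

lemma pi_gm_eq (n : ℕ) : Measure.pi (fun _ : Fin n => gm) =
    (volume : Measure (Fin n → ℝ)).withDensity (fun x => ENNReal.ofReal (∏ i, gphi (x i))) := by
  refine Measure.pi_eq fun s hs => ?_
  rw [withDensity_apply _ (MeasurableSet.univ_pi hs), volume_pi, Measure.restrict_pi_pi]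
  have hi : Integrable (fun x : Fin n → ℝ => ∏ i, gphi (x i))
      (Measure.pi fun i => volume.restrict (s i)) :=
    Integrable.fintype_prod (f := fun _ => gphi) fun i => gphi_integrable.restrict
  rw [← ofReal_integral_eq_lintegral_ofReal hi
    (ae_of_all _ fun x => Finset.prod_nonneg fun i _ => (gphi_pos _).le),
    integral_fintype_prod_eq_prod (f := fun _ => gphi),
    ENNReal.ofReal_prod_of_nonneg (fun i _ => integral_nonneg fun x => (gphi_pos _).le)]
  refine Finset.prod_congr rfl fun i _ => ?_
  rw [ofReal_integral_eq_lintegral_ofReal gphi_integrable.restrict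
    (ae_of_all _ fun x => (gphi_pos _).le), gm, ProbabilityTheory.gaussianReal_apply _ (by simp)]
  simp only [ProbabilityTheory.gaussianPDF, gphi_eq]

lemma gE_eq (n : ℕ) : gE n = (volume : Measure (Eu n)).withDensity
    (fun x => ENNReal.ofReal ((Real.sqrt (2 * Real.pi))⁻¹ ^ n * Real.exp (-‖x‖ ^ 2 / 2))) := by
  ext s hs
  rw [gE, Measure.map_apply (by fun_prop) hs, pi_gm_eq, withDensity_apply _ hs, withDensity_apply _
    (measurableSet_preimage (by fun_prop) hs),
    ← (PiLp.volume_preserving_toLp (Fin n)).setLIntegral_comp_preimage hs (by fun_prop)]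
  refine lintegral_congr fun x => ?_
  congr 1
  simp only [gphi, Finset.prod_mul_distrib, Finset.prod_const, Finset.card_univ, Fintype.card_fin]
  rw [← Real.exp_sum, EuclideanSpace.norm_sq_eq]
  congr 2
  simp [Finset.sum_div, neg_div, Finset.sum_neg_distrib]

lemma gauss_integrable (n : ℕ) : Integrable (fun x : Eu n => Real.exp (-‖x‖ ^ 2 / 2)) := by
  have h : ∫⁻ x : Eu n, ENNReal.ofReal ((Real.sqrt (2 * Real.pi))⁻¹ ^ n * Real.exp (-‖x‖ ^ 2 / 2)) = 1 := by
    rw [← setLIntegral_univ, ← withDensity_apply _ MeasurableSet.univ, ← gE_eq]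
    simp
  have h2 : Integrable (fun x : Eu n => (Real.sqrt (2 * Real.pi))⁻¹ ^ n * Real.exp (-‖x‖ ^ 2 / 2)) := by
    refine ⟨by fun_prop, ?_⟩
    rw [hasFiniteIntegral_iff_ofReal (ae_of_all _ fun x => by positivity), h]
    simp
  have := h2.const_mul ((Real.sqrt (2 * Real.pi))⁻¹ ^ n)⁻¹
  refine this.congr (ae_of_all _ fun x => ?_)
  have : (Real.sqrt (2 * Real.pi))⁻¹ ^ n ≠ 0 := by positivity
  field_simp

lemma gaussVol_eq (n : ℕ) {A : Set (Eu n)} (hA : MeasurableSet A) :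
    gaussVol n A = (gE n).real A := by
  rw [gaussVol, Measure.real, gE_eq, withDensity_apply _ hA,
    ← ofReal_integral_eq_lintegral_ofReal ((gauss_integrable n).restrict.const_mul _)
      (ae_of_all _ fun x => by positivity), ENNReal.toReal_ofReal (integral_nonneg fun x => by positivity),
      integral_const_mul]

lemma tendsto_Phi_ind {n : ℕ} {K : Set (Eu n)} (hK : IsClosed K) (hne : K.Nonempty) {c : ℕ → ℝ}
    (hc : Tendsto c atTop atTop) :
    Tendsto (fun k : ℕ => ∫ x, Phi (max ((k:ℝ) - (k:ℝ) ^ 2 * infDist x K) (-(c k))) ∂(gE n)) atTop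
      (𝓝 ((gE n).real K)) := by
  rw [← integral_indicator_one hK.measurableSet]
  refine tendsto_integral_of_dominated_convergence (fun _ => 1) (fun k => ?_) (integrable_const _)
    (fun k => ae_of_all _ fun x => ?_) (ae_of_all _ fun x => ?_)
  · refine (Phi_continuous.comp ?_).aestronglyMeasurable
    have := continuous_infDist_pt K
    fun_prop
  · rw [Real.norm_eq_abs, abs_of_pos (Phi_pos _)]; exact (Phi_lt_one _).le
  · by_cases hx : x ∈ K
    · have h0 : infDist x K = 0 := infDist_zero_of_mem hx
      rw [indicator_of_mem hx]
      refine Phi_tendsto_top.comp ?_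
      refine tendsto_atTop_mono (fun k => le_max_left _ _) ?_
      simpa [h0] using tendsto_natCast_atTop_atTop
    · have h0 : 0 < infDist x K := (hK.notMem_iff_infDist_pos hne).1 hx
      rw [indicator_of_notMem hx]
      refine Phi_tendsto_bot.comp ?_
      have h1 : Tendsto (fun k : ℕ => (k:ℝ) - (k:ℝ) ^ 2 * infDist x K) atTop atBot := by
        have a : Tendsto (fun k : ℕ => 1 - (k:ℝ) * infDist x K) atTop atBot := by
          have := (tendsto_natCast_atTop_atTop (R := ℝ)).atTop_mul_const h0
          exact tendsto_atBot_add_const_left _ 1 (tendsto_neg_atTop_atBot.comp this)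
        have := (tendsto_natCast_atTop_atTop (R := ℝ)).atTop_mul_atBot₀ a
        refine this.congr fun k => by ring
      have h2 : Tendsto (fun k => - c k) atTop atBot := tendsto_neg_atTop_atBot.comp hc
      rw [tendsto_atBot] at h1 h2 ⊢
      intro b
      filter_upwards [h1 b, h2 b] with k a1 a2 using max_le a1 a2

lemma gE_mem {n : ℕ} (hn : 2 ≤ n) {K : Set (Eu n)} (hK : IsConvexBody K) : (gE n).real K ∈ Ioo (0:ℝ) 1 := by
  have hpos : ∀ {U : Set (Eu n)}, IsOpen U → U.Nonempty → 0 < gE n U := by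
    intro U hU hne
    rw [pos_iff_ne_zero]
    intro h
    rw [gE_eq, withDensity_apply_eq_zero (by fun_prop)] at h
    have e : {x : Eu n | ENNReal.ofReal ((Real.sqrt (2 * Real.pi))⁻¹ ^ n * Real.exp (-‖x‖ ^ 2 / 2)) ≠ 0} = univ := by
      ext x
      simp only [mem_ofPred_eq, mem_univ, iff_true, ne_eq, ENNReal.ofReal_eq_zero, not_le]
      positivity
    rw [e, univ_inter] at h
    exact (hU.measure_pos volume hne).ne' h
  constructor
  · rw [measureReal_def, ENNReal.toReal_pos_iff]
    exact ⟨(hpos isOpen_interior hK.2.2).trans_le (measure_mono interior_subset), measure_lt_top _ _⟩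
  · have h1 : 0 < gE n Kᶜ := by
      apply hpos hK.2.1.isClosed.isOpen_compl
      by_contra h
      rw [not_nonempty_iff_eq_empty, compl_empty_iff] at h
      have : CompactSpace (Eu n) := ⟨h ▸ hK.2.1⟩
      have : Nontrivial (Eu n) := by
        have : Nonempty (Fin n) := ⟨⟨0, by omega⟩⟩
        infer_instance
      exact NormedSpace.noncompactSpace ℝ (Eu n) |>.1 isCompact_univ
    have h2 := probReal_compl_eq_one_sub (μ := gE n) hK.2.1.isClosed.measurableSet
    have : 0 < (gE n).real Kᶜ := by
      rw [measureReal_def, ENNReal.toReal_pos_iff]; exact ⟨h1, measure_lt_top _ _⟩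
    linarith

/-- Minkowski combination. -/
lemma body_comb {n : ℕ} {K L : Set (Eu n)} (hK : IsConvexBody K) (hL : IsConvexBody L) {l m : ℝ}
    (hl : 0 < l) : IsConvexBody (l • K + m • L) := by
  refine ⟨(hK.1.smul l).add (hL.1.smul m), (hK.2.1.smul l).add (hL.2.1.smul m), ?_⟩
  obtain ⟨x, hx⟩ := hK.2.2
  obtain ⟨y, hy⟩ := hL.2.2
  refine ⟨l • x + m • y, ?_⟩
  have hs : l • interior K + m • L ⊆ l • K + m • L :=
    add_subset_add (smul_set_mono interior_subset) Subset.rfl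
  refine interior_maximal hs ?_ (add_mem_add (smul_mem_smul_set hx) (smul_mem_smul_set (interior_subset hy)))
  exact (isOpen_interior.smul₀ hl.ne').add_right

theorem ehrhard {n : ℕ} (hn : 2 ≤ n) {K L : Set (Eu n)} (hK : IsConvexBody K) (hL : IsConvexBody L)
    {l m : ℝ} (hl : 0 < l) (hm : 0 < m) (hlm : l + m = 1) :
    l * PhiInv (gaussVol n K) + m * PhiInv (gaussVol n L) ≤ PhiInv (gaussVol n (l • K + m • L)) := by
  have hM := body_comb hK hL (m := m) hl
  have neK : K.Nonempty := hK.2.2.mono interior_subset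
  have neL : L.Nonempty := hL.2.2.mono interior_subset
  have neM : (l • K + m • L).Nonempty := hM.2.2.mono interior_subset
  set M := l • K + m • L with hMd
  rw [gaussVol_eq n hK.2.1.isClosed.measurableSet, gaussVol_eq n hL.2.1.isClosed.measurableSet,
    gaussVol_eq n hM.2.1.isClosed.measurableSet]
  have hq : ∀ x y, infDist (l • x + m • y) M ≤ l * infDist x K + m * infDist y L := by
    intro x y
    obtain ⟨a, ha, ea⟩ := hK.2.1.exists_infDist_eq_dist neK x
    obtain ⟨b, hb, eb⟩ := hL.2.1.exists_infDist_eq_dist neL y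
    have : l • a + m • b ∈ M := add_mem_add (smul_mem_smul_set ha) (smul_mem_smul_set hb)
    refine (infDist_le_dist_of_mem this).trans ?_
    rw [ea, eb]
    refine (dist_add_add_le _ _ _ _).trans ?_
    rw [dist_smul₀, dist_smul₀, Real.norm_of_nonneg hl.le, Real.norm_of_nonneg hm.le]
  have tsq : Tendsto (fun k : ℕ => (k:ℝ) ^ 2) atTop atTop :=
    (tendsto_pow_atTop two_ne_zero).comp tendsto_natCast_atTop_atTop
  have tc : ∀ {l m : ℝ}, 0 < l → Tendsto (fun k : ℕ => l * (k:ℝ) ^ 2 - m * k) atTop atTop := by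
    intro l m hl
    have a : Tendsto (fun k : ℕ => l * (k:ℝ) - m) atTop atTop :=
      tendsto_atTop_add_const_right _ _ ((tendsto_natCast_atTop_atTop (R := ℝ)).const_mul_atTop hl)
    have := (tendsto_natCast_atTop_atTop (R := ℝ)).atTop_mul_atTop₀ a
    refine this.congr fun k => by ring
  have tmin : Tendsto (fun k : ℕ => min (l * (k:ℝ) ^ 2 - m * k) (m * (k:ℝ) ^ 2 - l * k)) atTop atTop := by
    have h1 := tc (m := m) hl
    have h2 := tc (m := l) hm
    rw [Filter.tendsto_atTop] at h1 h2 ⊢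
    intro b
    filter_upwards [h1 b, h2 b] with k a1 a2 using le_min a1 a2
  have L1 := tendsto_Phi_ind hK.2.1.isClosed neK tsq
  have L2 := tendsto_Phi_ind hL.2.1.isClosed neL tsq
  have L3 := tendsto_Phi_ind hM.2.1.isClosed neM tmin
  refine le_of_tendsto_of_tendsto'
    ((((PhiInv_continuousAt (gE_mem hn hK)).tendsto.comp L1).const_mul l).add
      (((PhiInv_continuousAt (gE_mem hn hL)).tendsto.comp L2).const_mul m))
    ((PhiInv_continuousAt (gE_mem hn hM)).tendsto.comp L3) fun k => ?_
  have cq : ∀ A : Set (Eu n), Continuous (fun x => infDist x A) := fun A => continuous_infDist_pt A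
  have k0 : (0:ℝ) ≤ k := Nat.cast_nonneg k
  have k2 : (0:ℝ) ≤ (k:ℝ) ^ 2 := by positivity
  have nn : ∀ (A : Set (Eu n)) x, 0 ≤ (k:ℝ) ^ 2 * infDist x A := fun A x => mul_nonneg k2 infDist_nonneg
  have hl1 : l ≤ 1 := by linarith
  have hm1 : m ≤ 1 := by linarith
  have hlk : l * (k:ℝ) ≤ k := by nlinarith
  have hmk : m * (k:ℝ) ≤ k := by nlinarith
  have hlk2 : l * (k:ℝ) ^ 2 ≤ (k:ℝ) ^ 2 := by nlinarith
  have hlk0 : 0 ≤ l * (k:ℝ) := by positivity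
  have hmk0 : 0 ≤ m * (k:ℝ) := by positivity
  have hlk20 : 0 ≤ l * (k:ℝ) ^ 2 := by positivity
  have hmk20 : 0 ≤ m * (k:ℝ) ^ 2 := by positivity
  refine ehr_E n l m ((k:ℝ) ^ 2 + k) hl hm hlm _ _ _ ?_ ?_ ?_ ?_ ?_ ?_ ?_
  · have := cq K; fun_prop
  · have := cq L; fun_prop
  · have := cq M; fun_prop
  · intro x
    have := nn K x
    rw [abs_le]; constructor
    · exact le_trans (by linarith) (le_max_right _ _)
    · exact max_le (by linarith) (by linarith)
  · intro x
    have := nn L x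
    rw [abs_le]; constructor
    · exact le_trans (by linarith) (le_max_right _ _)
    · exact max_le (by linarith) (by linarith)
  · intro x
    have := nn M x
    rw [abs_le]; constructor
    · refine le_trans ?_ (le_max_right _ _)
      have := min_le_left (l * (k:ℝ) ^ 2 - m * k) (m * (k:ℝ) ^ 2 - l * k)
      linarith
    · refine max_le (by linarith) ?_
      rw [neg_le]; exact le_min (by linarith) (by linarith)
  · intro x y
    have h1 := nn K x
    have h2 := nn L y
    rcases max_choice ((k:ℝ) - (k:ℝ) ^ 2 * infDist x K) (-(k:ℝ) ^ 2) with e1 | e1 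
    · rcases max_choice ((k:ℝ) - (k:ℝ) ^ 2 * infDist y L) (-(k:ℝ) ^ 2) with e2 | e2
      · rw [e1, e2]
        refine le_trans ?_ (le_max_left _ _)
        have := mul_le_mul_of_nonneg_left (hq x y) k2
        have e : l * (k - (k:ℝ) ^ 2 * infDist x K) + m * (k - (k:ℝ) ^ 2 * infDist y L) =
          (l + m) * k - (k:ℝ) ^ 2 * (l * infDist x K + m * infDist y L) := by ring
        rw [e, hlm]; linarith
      · rw [e2]
        refine le_trans ?_ (le_max_right _ _)
        have a : max ((k:ℝ) - (k:ℝ) ^ 2 * infDist x K) (-(k:ℝ) ^ 2) ≤ k := max_le (by linarith) (by linarith)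
        have := mul_le_mul_of_nonneg_left a hl.le
        have := min_le_right (l * (k:ℝ) ^ 2 - m * k) (m * (k:ℝ) ^ 2 - l * k)
        linarith
    · rw [e1]
      refine le_trans ?_ (le_max_right _ _)
      have a : max ((k:ℝ) - (k:ℝ) ^ 2 * infDist y L) (-(k:ℝ) ^ 2) ≤ k := max_le (by linarith) (by linarith)
      have := mul_le_mul_of_nonneg_left a hm.le
      have := min_le_left (l * (k:ℝ) ^ 2 - m * k) (m * (k:ℝ) ^ 2 - l * k)
      linarith

/-- Quantitative convex body. -/
structure Bod {n : ℕ} (K : Set (Eu n)) (r R : ℝ) : Prop where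
  body : IsConvexBody K
  rpos : 0 < r
  inn : closedBall 0 r ⊆ K
  out : K ⊆ closedBall 0 R

section
variable {n : ℕ} {K : Set (Eu n)} {r R : ℝ}

lemma Bod.conv (hK : Bod K r R) : Convex ℝ K := hK.body.1
lemma Bod.comp (hK : Bod K r R) : IsCompact K := hK.body.2.1
lemma Bod.nhds (hK : Bod K r R) : K ∈ 𝓝 (0 : Eu n) :=
  mem_of_superset (closedBall_mem_nhds _ hK.rpos) hK.inn
lemma Bod.zero_mem (hK : Bod K r R) : (0 : Eu n) ∈ K := mem_of_mem_nhds hK.nhds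
lemma Bod.norm_le (hK : Bod K r R) {x : Eu n} (hx : x ∈ K) : ‖x‖ ≤ R := by simpa using hK.out hx
lemma Bod.Rnn (hK : Bod K r R) : 0 ≤ R := by simpa using hK.norm_le hK.zero_mem
lemma Bod.absorbent (hK : Bod K r R) : Absorbent ℝ K := absorbent_nhds_zero hK.nhds
lemma Bod.fr_sub (hK : Bod K r R) : frontier K ⊆ K := hK.comp.isClosed.frontier_subset

lemma Bod.le_supp (hK : Bod K r R) {x : Eu n} (hx : x ∈ K) (v : Eu n) : ⟪x, v⟫ ≤ suppFun K v := by
  refine le_csSup ?_ (mem_image_of_mem _ hx)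
  exact (hK.comp.image (by fun_prop)).bddAbove

lemma Bod.supp_le (hK : Bod K r R) {v : Eu n} {c : ℝ} (h : ∀ x ∈ K, ⟪x, v⟫ ≤ c) : suppFun K v ≤ c := by
  refine csSup_le ⟨_, mem_image_of_mem _ hK.zero_mem⟩ ?_
  rintro _ ⟨x, hx, rfl⟩
  exact h x hx

lemma Bod.supp_ge (hK : Bod K r R) {v : Eu n} (hv : ‖v‖ = 1) : r ≤ suppFun K v := by
  have h : r • v ∈ K := hK.inn (by simp [norm_smul, hv, abs_of_pos hK.rpos])
  have := hK.le_supp h v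
  rwa [real_inner_smul_left, real_inner_self_eq_norm_sq, hv, one_pow, mul_one] at this

lemma Bod.supp_pos (hK : Bod K r R) {v : Eu n} (hv : ‖v‖ = 1) : 0 < suppFun K v :=
  hK.rpos.trans_le (hK.supp_ge hv)

lemma Bod.supp_le_R (hK : Bod K r R) {v : Eu n} (hv : ‖v‖ = 1) : suppFun K v ≤ R := by
  refine hK.supp_le fun x hx => (real_inner_le_norm _ _).trans ?_
  rw [hv, mul_one]; exact hK.norm_le hx

lemma Bod.supp_sub (hK : Bod K r R) (v w : Eu n) : suppFun K v - suppFun K w ≤ R * ‖v - w‖ := by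
  rw [sub_le_iff_le_add]
  refine hK.supp_le fun x hx => ?_
  have h1 := hK.le_supp hx w
  have h2 : ⟪x, v - w⟫ ≤ R * ‖v - w‖ := (real_inner_le_norm _ _).trans
    (mul_le_mul_of_nonneg_right (hK.norm_le hx) (norm_nonneg _))
  rw [inner_sub_right] at h2
  linarith

lemma Bod.supp_abs (hK : Bod K r R) (v w : Eu n) : |suppFun K v - suppFun K w| ≤ R * ‖v - w‖ := by
  rw [abs_le]
  have h1 := hK.supp_sub v w
  have h2 := hK.supp_sub w v
  rw [norm_sub_rev] at h2
  constructor <;> linarith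

lemma Bod.supp_cont (hK : Bod K r R) : Continuous (suppFun K) := by
  have : LipschitzWith ⟨R, hK.Rnn⟩ (suppFun K) := LipschitzWith.of_dist_le_mul fun v w => by
    rw [Real.dist_eq, dist_eq_norm]; exact hK.supp_abs v w
  exact this.continuous

lemma Bod.gauge_lip (hK : Bod K r R) : LipschitzWith ⟨r⁻¹, inv_nonneg.2 hK.rpos.le⟩ (gauge K) := by
  have := hK.conv.lipschitzWith_gauge (r := ⟨r, hK.rpos.le⟩) hK.rpos (ball_subset_closedBall.trans hK.inn)
  have e : (⟨r⁻¹, inv_nonneg.2 hK.rpos.le⟩ : ℝ≥0) = ⟨r, hK.rpos.le⟩⁻¹ := rfl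
  rw [e]; exact this

lemma Bod.gauge_abs (hK : Bod K r R) (x y : Eu n) : |gauge K x - gauge K y| ≤ r⁻¹ * ‖x - y‖ := by
  have := hK.gauge_lip.dist_le_mul x y
  rwa [Real.dist_eq, dist_eq_norm] at this

lemma Bod.gauge_fr (hK : Bod K r R) {x : Eu n} : gauge K x = 1 ↔ x ∈ frontier K :=
  gauge_eq_one_iff_mem_frontier hK.conv hK.nhds

lemma Bod.gauge_le_one (hK : Bod K r R) {x : Eu n} : gauge K x ≤ 1 ↔ x ∈ K := by
  rw [gauge_le_one_iff_mem_closure hK.conv hK.nhds, hK.comp.isClosed.closure_eq]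

lemma Bod.gauge_pos (hK : Bod K r R) {x : Eu n} (hx : x ≠ 0) : 0 < gauge K x :=
  (_root_.gauge_pos hK.absorbent ((NormedSpace.isVonNBounded_iff ℝ).2 hK.comp.isBounded)).2 hx

lemma gauge_sm {s : ℝ} (hs : 0 ≤ s) (x : Eu n) : gauge K (s • x) = s * gauge K x := by
  rw [gauge_smul_of_nonneg hs, smul_eq_mul]

/-- radial projection lies on the frontier -/
lemma Bod.proj_fr (hK : Bod K r R) {x : Eu n} (hx : x ≠ 0) : (gauge K x)⁻¹ • x ∈ frontier K := by
  have h := hK.gauge_pos hx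
  rw [← hK.gauge_fr, gauge_sm (by positivity), inv_mul_cancel₀ h.ne']

lemma Bod.inner_le_gauge (hK : Bod K r R) (x v : Eu n) : ⟪x, v⟫ ≤ gauge K x * suppFun K v := by
  by_cases hx : x = 0
  · simp [hx]
  have h := hK.gauge_pos hx
  have := hK.le_supp (hK.fr_sub (hK.proj_fr hx)) v
  rw [real_inner_smul_left, inv_mul_le_iff₀ h] at this
  exact this

/-- Every frontier point has a unit normal. -/
lemma Bod.exists_normal (hK : Bod K r R) {x : Eu n} (hx : x ∈ frontier K) :
    ∃ v : Eu n, ‖v‖ = 1 ∧ ⟪x, v⟫ = suppFun K v := by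
  have hxi : x ∉ interior K := hx.2
  have hne : (interior K).Nonempty := hK.body.2.2
  obtain ⟨f, hf⟩ := geometric_hahn_banach_open_point hK.conv.interior isOpen_interior hxi
  obtain ⟨w, rfl⟩ := (InnerProductSpace.toDual ℝ (Eu n)).surjective f
  simp only [InnerProductSpace.toDual_apply_apply] at hf
  have hw : w ≠ 0 := by
    rintro rfl
    obtain ⟨a, ha⟩ := hne
    simpa using hf a ha
  have hcl : ∀ a ∈ K, ⟪w, a⟫ ≤ ⟪w, x⟫ := by
    intro a ha
    have : K ⊆ closure (interior K) := by
      rw [hK.conv.closure_interior_eq_closure_of_nonempty_interior hne]; exact subset_closure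
    have := this ha
    have hc : IsClosed {a : Eu n | ⟪w, a⟫ ≤ ⟪w, x⟫} := isClosed_le (by fun_prop) (by fun_prop)
    exact closure_minimal (fun a ha => (hf a ha).le) hc this
  have hwp : 0 < ‖w‖ := norm_pos_iff.2 hw
  refine ⟨‖w‖⁻¹ • w, by simp [norm_smul, hwp.ne'], le_antisymm (hK.le_supp (hK.fr_sub hx) _) ?_⟩
  refine hK.supp_le fun a ha => ?_
  rw [real_inner_smul_right, real_inner_smul_right, real_inner_comm, real_inner_comm w x]
  exact mul_le_mul_of_nonneg_left (hcl a ha) (by positivity)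

end

/-- Cone over a set, without the apex. -/
def cone {n : ℕ} (F : Set (Eu n)) : Set (Eu n) := {z | ∃ s ∈ Ioc (0:ℝ) 1, ∃ x ∈ F, z = s • x}

lemma lint_pow {h : ℝ} (hh : 0 < h) {d : ℕ} :
    ∫⁻ τ in Ioc 0 h, ENNReal.ofReal ((τ / h) ^ d) = ENNReal.ofReal (h / (d + 1)) := by
  rw [← ofReal_integral_eq_lintegral_ofReal]
  · rw [← intervalIntegral.integral_of_le hh.le]
    congr 1
    rw [intervalIntegral.integral_comp_div (fun x => x ^ d) hh.ne']
    simp [hh.ne', integral_pow, div_eq_mul_inv]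
  · have : Continuous fun τ : ℝ => (τ / h) ^ d := by fun_prop
    exact (this.integrableOn_Icc).mono_set Ioc_subset_Icc_self
  · refine (ae_restrict_iff' measurableSet_Ioc).2 (ae_of_all _ fun τ hτ => ?_)
    have := hτ.1
    positivity

/-- Splitting off a direction. -/
lemma split_dir {n : ℕ} (u : Eu n) (hu : ‖u‖ = 1) :
    ∃ e : Eu n ≃ᵐ ℝ × ((ℝ ∙ u)ᗮ : Submodule ℝ (Eu n)), MeasurePreserving e volume volume ∧
      ∀ q, e.symm q = q.1 • u + (q.2 : Eu n) := by
  have h1 := (Submodule.measurePreserving_measurableEquivProd (ℝ ∙ u) (0 : Eu n))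
  rw [InnerProductSpace.euclideanHausdorffMeasure_eq_volume] at h1
  let f : ℝ ≃ₗᵢ[ℝ] (ℝ ∙ u) := LinearIsometryEquiv.toSpanUnitSingleton u hu
  have h2 : MeasurePreserving f.symm.toHomeomorph.toMeasurableEquiv volume volume :=
    f.symm.measurePreserving
  let g := MeasurableEquiv.prodCongr f.symm.toHomeomorph.toMeasurableEquiv
    (MeasurableEquiv.refl ((ℝ ∙ u)ᗮ : Submodule ℝ (Eu n)))
  have h3 : MeasurePreserving g volume volume := h2.prod (MeasurePreserving.id volume)
  refine ⟨((ℝ ∙ u).measurableEquivProd (0 : Eu n)).trans g, h1.trans h3, fun q => ?_⟩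
  have : (((ℝ ∙ u).measurableEquivProd (0 : Eu n)).trans g).symm q =
    ((ℝ ∙ u).measurableEquivProd (0 : Eu n)).symm (g.symm q) := rfl
  rw [this, Submodule.measurableEquivProd_symm_apply]
  have e2 : g.symm q = (f q.1, q.2) := rfl
  rw [e2]
  simp [f]

lemma inner_u {n : ℕ} {u : Eu n} (hu : ‖u‖ = 1) (τ : ℝ) (p : ((ℝ ∙ u)ᗮ : Submodule ℝ (Eu n))) :
    ⟪τ • u + (p : Eu n), u⟫ = τ := by
  have := Submodule.mem_orthogonal_singleton_iff_inner_left.1 p.2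
  rw [inner_add_left, real_inner_smul_left, real_inner_self_eq_norm_sq, hu, this]; simp

lemma flat_cone' {d : ℕ} (u : Eu (d+1)) (hu : ‖u‖ = 1) {h : ℝ} (hh : 0 < h) {F : Set (Eu (d+1))}
    (hF : MeasurableSet F) (hFu : ∀ x ∈ F, ⟪x, u⟫ = h) :
    volume (cone F) = ENNReal.ofReal (h / (d + 1)) * μHE[d] F := by
  let W : Submodule ℝ (Eu (d+1)) := (ℝ ∙ u)ᗮ
  obtain ⟨e, he, hes⟩ : ∃ e : Eu (d+1) ≃ᵐ ℝ × W, MeasurePreserving e volume volume ∧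
      ∀ q, e.symm q = q.1 • u + (q.2 : Eu (d+1)) := split_dir u hu
  have hW : Module.finrank ℝ W = d := by
    have : Fact (Module.finrank ℝ (Eu (d+1)) = d + 1) := ⟨by simp⟩
    exact Submodule.finrank_orthogonal_span_singleton (by rintro rfl; simp at hu)
  let j : W → Eu (d+1) := fun p => h • u + (p : Eu (d+1))
  have hj : Isometry j := by
    refine Isometry.of_dist_eq fun p q => ?_
    simp only [j, dist_add_left]; rfl
  set B : Set W := j ⁻¹' F with hB
  have hBm : MeasurableSet B := hj.continuous.measurable hF
  have hdec : ∀ x : Eu (d+1), ∃ q : ℝ × W, x = q.1 • u + (q.2 : Eu (d+1)) := fun x =>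
    ⟨e x, by rw [← hes]; simp⟩
  have hFB : F = j '' B := by
    apply Subset.antisymm
    · intro x hx
      obtain ⟨q, hq⟩ := hdec x
      have h1 := hFu x hx
      rw [hq, inner_u hu] at h1
      rw [h1] at hq
      exact ⟨q.2, by rw [hB, mem_preimage]; simp only [j]; rwa [← hq], hq.symm⟩
    · rintro _ ⟨p, hp, rfl⟩; exact hp
  have hvB : μHE[d] F = volume B := by
    rw [hFB, hj.euclideanHausdorffMeasure_image]
    have := InnerProductSpace.euclideanHausdorffMeasure_eq_volume (V := W)
    rw [hW] at this
    rw [this]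
  set T : Set (ℝ × W) := {q | q.1 ∈ Ioc 0 h ∧ (h / q.1) • q.2 ∈ B} with hT
  have hTm : MeasurableSet T := by
    refine (measurableSet_Ioc.preimage measurable_fst).inter ?_
    have : Measurable (fun q : ℝ × W => (h / q.1) • q.2) := by fun_prop
    exact this hBm
  have hcT : e.symm ⁻¹' (cone F) = T := by
    ext q
    simp only [mem_preimage, hes, cone, hT, hB, j]
    constructor
    · rintro ⟨s, hs, x, hx, hq⟩
      obtain ⟨q', hq'⟩ := hdec x
      have h1 := hFu x hx
      rw [hq', inner_u hu] at h1
      have h2 := congrArg (fun z => ⟪z, u⟫) hq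
      simp only [inner_u hu, real_inner_smul_left, hFu x hx] at h2
      have hsp := hs.1
      refine ⟨⟨by rw [h2]; positivity, by rw [h2]; nlinarith [hs.2]⟩, ?_⟩
      have h3 : (q.2 : Eu (d+1)) = s • (q'.2 : Eu (d+1)) := by
        rw [hq', h1, h2, smul_add, smul_smul] at hq
        exact add_left_cancel hq
      have h4 : q.2 = s • q'.2 := Subtype.ext h3
      have h5 : (h / q.1) • q.2 = q'.2 := by
        rw [h4, h2, smul_smul]
        have : h / (s * h) * s = 1 := by field_simp
        rw [this, one_smul]
      change h • u + (((h / q.1) • q.2 : W) : Eu (d+1)) ∈ F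
      rw [h5, ← h1, ← hq']; exact hx
    · rintro ⟨⟨h1, h2⟩, h3⟩
      refine ⟨q.1 / h, ⟨by positivity, (div_le_one hh).2 h2⟩, _, h3, ?_⟩
      rw [smul_add, smul_smul, Submodule.coe_smul, smul_smul]
      have e1 : q.1 / h * h = q.1 := by field_simp
      have e2 : q.1 / h * (h / q.1) = 1 := by field_simp
      rw [e1, e2, one_smul]
  have hv : volume (cone F) = volume T := by
    rw [← hcT, (he.symm e).measure_preimage_equiv]
  rw [hv, hvB, Measure.volume_eq_prod, Measure.prod_apply hTm, ← lint_pow hh,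
    ← lintegral_mul_const _ (by fun_prop), ← lintegral_indicator measurableSet_Ioc]
  refine lintegral_congr fun τ => ?_
  by_cases hτ : τ ∈ Ioc 0 h
  · rw [indicator_of_mem hτ]
    have hp := hτ.1
    have : Prod.mk τ ⁻¹' T = (τ / h) • B := by
      ext p
      rw [mem_smul_set_iff_inv_smul_mem₀ (by positivity)]
      simp [hT, hτ.1, hτ.2]
    rw [this, Measure.addHaar_smul, hW, abs_of_nonneg (by positivity)]
  · rw [indicator_of_notMem hτ]
    have : Prod.mk τ ⁻¹' T = ∅ := by
      ext p; simp only [hT, mem_preimage, mem_empty_iff_false, iff_false]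
      exact fun hh => hτ hh.1
    rw [this, measure_empty]

/-- Volume of flat cones. -/
lemma flat_cone {n : ℕ} (hn : 2 ≤ n) : ∃ κ : ℝ≥0, κ ≠ 0 ∧ ∀ (u : Eu n) (_ : ‖u‖ = 1) (h : ℝ) (_ : 0 < h)
    (F : Set (Eu n)) (_ : MeasurableSet F) (_ : ∀ x ∈ F, ⟪x, u⟫ = h),
    volume (cone F) = κ * ENNReal.ofReal h * μH[(n:ℝ) - 1] F := by
  obtain ⟨d, rfl⟩ : ∃ d, n = d + 1 := ⟨n - 1, by omega⟩
  set a : ℝ≥0 := Measure.addHaarScalarFactor (volume : Measure (EuclideanSpace ℝ (Fin d))) μH[d] with ha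
  have ha0 : a ≠ 0 := Measure.addHaarScalarFactor_volume_hausdorffMeasure_ne_zero d
  refine ⟨a / (d + 1), by positivity, fun u hu h hh F hF hFu => ?_⟩
  rw [flat_cone' u hu hh hF hFu, Measure.euclideanHausdorffMeasure_def, ← ha]
  have e : (((d + 1 : ℕ) : ℝ) - 1) = d := by push_cast; ring
  rw [e, Measure.smul_apply, ENNReal.smul_def, smul_eq_mul, ← mul_assoc]
  congr 1
  rw [ENNReal.ofReal_div_of_pos (by positivity), ENNReal.coe_div (by positivity), ENNReal.div_eq_inv_mul,
    ENNReal.div_eq_inv_mul]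
  have : ENNReal.ofReal ((d:ℝ) + 1) = ((d + 1 : ℝ≥0) : ℝ≥0∞) := by
    rw [ENNReal.ofReal_add (by positivity) (by positivity)]; simp
  rw [this]
  ring

/-- `F` consists of frontier points having a normal close to `u`. -/
def NearN {n : ℕ} (K : Set (Eu n)) (ε : ℝ) (u : Eu n) (F : Set (Eu n)) : Prop :=
  F ⊆ frontier K ∧ ∀ x ∈ F, ∃ v : Eu n, ‖v‖ = 1 ∧ ‖v - u‖ ≤ ε ∧ ⟪x, v⟫ = suppFun K v

/-- The flattening map. -/
def flatten {n : ℕ} (K : Set (Eu n)) (u z : Eu n) : Eu n :=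
  z + (gauge K z * suppFun K u - ⟪z, u⟫) • u

lemma subset_cone {n : ℕ} (F : Set (Eu n)) : F ⊆ cone F := fun x hx => ⟨1, by simp, x, hx, by simp⟩

lemma flatten_smul {n : ℕ} (K : Set (Eu n)) (u z : Eu n) {s : ℝ} (hs : 0 ≤ s) :
    flatten K u (s • z) = s • flatten K u z := by
  simp only [flatten, gauge_sm hs, real_inner_smul_left, smul_add, smul_smul]
  congr 2; ring

lemma flatten_cone {n : ℕ} (K : Set (Eu n)) (u : Eu n) (F : Set (Eu n)) :
    flatten K u '' cone F = cone (flatten K u '' F) := by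
  ext z; constructor
  · rintro ⟨_, ⟨s, hs, x, hx, rfl⟩, rfl⟩
    exact ⟨s, hs, _, mem_image_of_mem _ hx, flatten_smul K u x hs.1.le⟩
  · rintro ⟨s, hs, _, ⟨x, hx, rfl⟩, rfl⟩
    exact ⟨s • x, ⟨s, hs, x, hx, rfl⟩, flatten_smul K u x hs.1.le⟩

lemma flatten_diff {n : ℕ} {K : Set (Eu n)} {r R ε : ℝ} (hK : Bod K r R) {u : Eu n}
    {F : Set (Eu n)} (hF : NearN K ε u F) {z z' : Eu n} (hz : z ∈ cone F) :
    (gauge K z * suppFun K u - ⟪z, u⟫) - (gauge K z' * suppFun K u - ⟪z', u⟫) ≤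
      ε * (R / r + 1) * ‖z - z'‖ := by
  obtain ⟨s, hs, x, hx, rfl⟩ := hz
  obtain ⟨v, hv, hvu, hxv⟩ := hF.2 x hx
  have h1 : gauge K (s • x) = s := by rw [gauge_sm hs.1.le, hK.gauge_fr.2 (hF.1 hx), mul_one]
  have h2 := hK.inner_le_gauge z' v
  have h3 : ⟪s • x, v⟫ = gauge K (s • x) * suppFun K v := by
    rw [h1, real_inner_smul_left, hxv]
  have h4 := hK.gauge_abs (s • x) z'
  have h5 : |suppFun K u - suppFun K v| ≤ R * ε := by
    refine (hK.supp_abs u v).trans ?_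
    rw [norm_sub_rev]; exact mul_le_mul_of_nonneg_left hvu hK.Rnn
  have h6 : (gauge K (s • x) - gauge K z') * (suppFun K u - suppFun K v) ≤
      (r⁻¹ * ‖s • x - z'‖) * (R * ε) := by
    refine (le_abs_self _).trans ?_
    rw [abs_mul]
    exact mul_le_mul h4 h5 (abs_nonneg _) (by have := hK.rpos; positivity)
  have h7 : - ⟪s • x - z', u - v⟫ ≤ ‖s • x - z'‖ * ε := by
    refine (neg_le_abs _).trans ((abs_real_inner_le_norm _ _).trans ?_)
    rw [norm_sub_rev u v]; exact mul_le_mul_of_nonneg_left hvu (norm_nonneg _)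
  simp only [inner_sub_left, inner_sub_right] at h7
  have e : ε * (R / r + 1) * ‖s • x - z'‖ = (r⁻¹ * ‖s • x - z'‖) * (R * ε) + ‖s • x - z'‖ * ε := by
    ring
  rw [e]
  nlinarith

lemma flatten_approx {n : ℕ} {K : Set (Eu n)} {r R ε : ℝ} (hK : Bod K r R) {u : Eu n} (hu : ‖u‖ = 1)
    {F : Set (Eu n)} (hF : NearN K ε u F) {c : ℝ≥0} (hc : ε * (R / r + 1) ≤ c) :
    ApproximatesLinearOn (flatten K u) (ContinuousLinearMap.id ℝ (Eu n)) (cone F) c := by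
  intro z hz z' hz'
  have e : flatten K u z - flatten K u z' - (ContinuousLinearMap.id ℝ (Eu n)) (z - z') =
    ((gauge K z * suppFun K u - ⟪z, u⟫) - (gauge K z' * suppFun K u - ⟪z', u⟫)) • u := by
    simp only [flatten, ContinuousLinearMap.id_apply]; module
  rw [e, norm_smul, hu, mul_one, Real.norm_eq_abs]
  refine le_trans (abs_le'.2 ⟨flatten_diff hK hF hz, ?_⟩) (mul_le_mul_of_nonneg_right hc (norm_nonneg _))
  have := flatten_diff hK hF hz' (z' := z)
  rw [norm_sub_rev] at this
  linarith

/-- Universal constant. -/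
def kap (n : ℕ) : ℝ≥0 := if h : 2 ≤ n then (flat_cone h).choose else 0

lemma kap_ne {n : ℕ} (hn : 2 ≤ n) : kap n ≠ 0 := by
  rw [kap, dif_pos hn]; exact (flat_cone hn).choose_spec.1

lemma kap_spec {n : ℕ} (hn : 2 ≤ n) (u : Eu n) (hu : ‖u‖ = 1) (h : ℝ) (hh : 0 < h)
    (F : Set (Eu n)) (hF : MeasurableSet F) (hF2 : ∀ x ∈ F, ⟪x, u⟫ = h) :
    volume (cone F) = kap n * ENNReal.ofReal h * μH[(n:ℝ) - 1] F := by
  rw [kap, dif_pos hn]; exact (flat_cone hn).choose_spec.2 u hu h hh F hF hF2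

/-- The curved cone comparison. -/
lemma cone_comp {n : ℕ} (hn : 2 ≤ n) {A : ℝ≥0} (hA : 1 < A) : ∃ c : ℝ, 0 < c ∧
    ∀ (K : Set (Eu n)) (r R ε : ℝ), Bod K r R → ε * (R / r + 1) ≤ c → ∀ u : Eu n, ‖u‖ = 1 →
    ∀ F, MeasurableSet F → NearN K ε u F →
      volume (cone F) ≤ A * (kap n * ENNReal.ofReal (suppFun K u) * μH[(n:ℝ) - 1] F) ∧
      kap n * ENNReal.ofReal (suppFun K u) * μH[(n:ℝ) - 1] F ≤ A * volume (cone F) := by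
  set a := NNReal.sqrt A with ha
  have haa : a * a = A := NNReal.mul_self_sqrt A
  have ha1 : 1 < a := by rw [ha, ← NNReal.sqrt_one]; exact NNReal.sqrt_lt_sqrt.2 hA
  have ha0 : a ≠ 0 := by positivity
  have hd : ENNReal.ofReal |(ContinuousLinearMap.id ℝ (Eu n)).det| = 1 := by
    simp [ContinuousLinearMap.det]
  have E1 := addHaar_image_le_mul_of_det_lt (volume : Measure (Eu n)) (ContinuousLinearMap.id ℝ (Eu n))
    (m := a) (by rw [hd]; exact_mod_cast ha1)
  have E2 := mul_le_addHaar_image_of_lt_det (volume : Measure (Eu n)) (ContinuousLinearMap.id ℝ (Eu n))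
    (m := a⁻¹) (by rw [hd]; exact_mod_cast inv_lt_one_of_one_lt₀ ha1)
  have hd0 : (0:ℝ) ≤ (n:ℝ) - 1 := by
    have : (2:ℝ) ≤ n := by exact_mod_cast hn
    linarith
  have E3 : ∀ᶠ c : ℝ≥0 in 𝓝[>] 0, (1 + c) ^ ((n:ℝ) - 1) < a := by
    have : ContinuousAt (fun c : ℝ≥0 => (1 + c) ^ ((n:ℝ) - 1)) 0 :=
      ((NNReal.continuous_rpow_const hd0).comp (by fun_prop : Continuous fun c : ℝ≥0 => 1 + c)).continuousAt
    exact nhdsWithin_le_nhds (this.eventually_lt_const (by simpa using ha1))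
  have E4 : ∀ᶠ c : ℝ≥0 in 𝓝[>] 0, ((1 - c)⁻¹) ^ ((n:ℝ) - 1) < a := by
    have : ContinuousAt (fun c : ℝ≥0 => ((1 - c)⁻¹) ^ ((n:ℝ) - 1)) 0 := by
      refine (NNReal.continuous_rpow_const hd0).continuousAt.comp (f := fun c : ℝ≥0 => (1 - c)⁻¹) ?_
      refine ContinuousAt.inv₀ ?_ (by simp)
      exact (continuous_const.sub continuous_id).continuousAt
    exact nhdsWithin_le_nhds (this.eventually_lt_const (by simpa using ha1))
  have E5 : ∀ᶠ c : ℝ≥0 in 𝓝[>] 0, c < 1 := nhdsWithin_le_nhds (Iio_mem_nhds one_pos)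
  obtain ⟨c, h1, h2, h3, h4, h5, h6⟩ :=
    (E1.and (E2.and (E3.and (E4.and (E5.and self_mem_nhdsWithin))))).exists
  refine ⟨c, by exact_mod_cast h6, fun K r R ε hK hε u hu F hF hFn => ?_⟩
  have hap := flatten_approx hK hu hFn hε
  have hupp := h1 _ _ hap
  have hlow := h2 _ _ hap
  rw [flatten_cone] at hupp hlow
  have hapF : ApproximatesLinearOn (flatten K u) (ContinuousLinearMap.id ℝ (Eu n)) F c :=
    hap.mono_set (subset_cone F)
  have hc1 : (c:ℝ) < 1 := by exact_mod_cast h5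
  have low : ∀ x ∈ F, ∀ y ∈ F, ‖x - y‖ ≤ ((1 - c)⁻¹ : ℝ≥0) * ‖flatten K u x - flatten K u y‖ := by
    intro x hx y hy
    have := hapF x hx y hy
    simp only [ContinuousLinearMap.id_apply] at this
    have t : ‖x - y‖ ≤ ‖flatten K u x - flatten K u y‖ + ‖flatten K u x - flatten K u y - (x - y)‖ := by
      have := norm_sub_le (flatten K u x - flatten K u y) (flatten K u x - flatten K u y - (x - y))
      rwa [sub_sub_cancel] at this
    rw [NNReal.coe_inv, NNReal.coe_sub h5.le, NNReal.coe_one, ← div_eq_inv_mul, le_div_iff₀ (by linarith)]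
    linarith
  have inj : InjOn (flatten K u) F := by
    intro x hx y hy hxy
    have := low x hx y hy
    rw [hxy, sub_self, norm_zero, mul_zero] at this
    exact sub_eq_zero.1 (norm_le_zero_iff.1 this)
  have hcont : Continuous (flatten K u) := by
    have := hK.gauge_lip.continuous
    unfold flatten
    fun_prop
  have hm : MeasurableSet (flatten K u '' F) := hF.image_of_continuousOn_injOn hcont.continuousOn inj
  have hflat := kap_spec hn u hu _ (hK.supp_pos hu) _ hm (by
    rintro _ ⟨x, hx, rfl⟩
    rw [flatten, hK.gauge_fr.2 (hFn.1 hx), inner_add_left, real_inner_smul_left,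
      real_inner_self_eq_norm_sq, hu]; ring)
  have lip1 : LipschitzOnWith (1 + c) (flatten K u) F := by
    refine LipschitzOnWith.of_dist_le_mul fun x hx y hy => ?_
    have := hapF x hx y hy
    simp only [ContinuousLinearMap.id_apply] at this
    rw [dist_eq_norm, dist_eq_norm]
    have t := norm_add_le (flatten K u x - flatten K u y - (x - y)) (x - y)
    rw [sub_add_cancel] at t
    push_cast; linarith
  have lip2 : LipschitzOnWith ((1 - c)⁻¹) (Function.invFunOn (flatten K u) F) (flatten K u '' F) := by
    refine LipschitzOnWith.of_dist_le_mul ?_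
    rintro _ ⟨x, hx, rfl⟩ _ ⟨y, hy, rfl⟩
    rw [inj.leftInvOn_invFunOn hx, inj.leftInvOn_invFunOn hy, dist_eq_norm, dist_eq_norm]
    exact low x hx y hy
  have H1 := lip1.hausdorffMeasure_image_le hd0
  have H2 := lip2.hausdorffMeasure_image_le hd0
  rw [inj.leftInvOn_invFunOn.image_image] at H2
  have H1' : μH[(n:ℝ) - 1] (flatten K u '' F) ≤ a * μH[(n:ℝ) - 1] F := by
    refine H1.trans (mul_le_mul_left ?_ _)
    rw [← ENNReal.coe_rpow_of_nonneg _ hd0]; exact_mod_cast h3.le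
  have H2' : μH[(n:ℝ) - 1] F ≤ a * μH[(n:ℝ) - 1] (flatten K u '' F) := by
    refine H2.trans (mul_le_mul_left ?_ _)
    rw [← ENNReal.coe_rpow_of_nonneg _ hd0]; exact_mod_cast h4.le
  have hlow' : volume (cone F) ≤ a * volume (cone (flatten K u '' F)) := by
    have := mul_le_mul_right hlow (a : ℝ≥0∞)
    rwa [← mul_assoc, ← ENNReal.coe_mul, mul_inv_cancel₀ ha0, ENNReal.coe_one, one_mul] at this
  have haa' : (A : ℝ≥0∞) = a * a := by exact_mod_cast haa.symm
  constructor
  · calc volume (cone F) ≤ a * volume (cone (flatten K u '' F)) := hlow'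
      _ = a * (kap n * ENNReal.ofReal (suppFun K u) * μH[(n:ℝ) - 1] (flatten K u '' F)) := by rw [hflat]
      _ ≤ a * (kap n * ENNReal.ofReal (suppFun K u) * (a * μH[(n:ℝ) - 1] F)) := by gcongr
      _ = _ := by rw [haa']; ring
  · calc kap n * ENNReal.ofReal (suppFun K u) * μH[(n:ℝ) - 1] F 
        ≤ kap n * ENNReal.ofReal (suppFun K u) * (a * μH[(n:ℝ) - 1] (flatten K u '' F)) := by gcongr
      _ = a * volume (cone (flatten K u '' F)) := by rw [hflat]; ring
      _ ≤ a * (a * volume (cone F)) := by gcongr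
      _ = _ := by rw [haa']; ring

/-- Points with a normal in `C`. -/
def Eset {n : ℕ} (K C : Set (Eu n)) : Set (Eu n) := {x | x ∈ frontier K ∧ ∃ v ∈ C, ⟪x, v⟫ = suppFun K v}

/-- Spherical cap. -/
def cap {n : ℕ} (u : Eu n) (ε : ℝ) : Set (Eu n) := {v | ‖v‖ = 1 ∧ ‖v - u‖ ≤ ε}

lemma cap_compact {n : ℕ} (u : Eu n) (ε : ℝ) : IsCompact (cap u ε) := by
  have : cap u ε = sphere 0 1 ∩ {v | ‖v - u‖ ≤ ε} := by ext v; simp [cap]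
  rw [this]
  exact (isCompact_sphere _ _).inter_right (isClosed_le (by fun_prop) (by fun_prop))

section
variable {n : ℕ} {K : Set (Eu n)} {r R : ℝ}

lemma Bod.fr_compact (hK : Bod K r R) : IsCompact (frontier K) :=
  hK.comp.of_isClosed_subset isClosed_frontier hK.fr_sub

lemma Bod.Eset_compact (hK : Bod K r R) {C : Set (Eu n)} (hC : IsCompact C) : IsCompact (Eset K C) := by
  have h1 : IsCompact ((frontier K ×ˢ C) ∩ {p : Eu n × Eu n | ⟪p.1, p.2⟫ = suppFun K p.2}) := by
    refine (hK.fr_compact.prod hC).inter_right ?_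
    have := hK.supp_cont
    exact isClosed_eq (by fun_prop) (by fun_prop)
  have h2 : Eset K C = Prod.fst '' ((frontier K ×ˢ C) ∩ {p : Eu n × Eu n | ⟪p.1, p.2⟫ = suppFun K p.2}) := by
    ext x; constructor
    · rintro ⟨hx, v, hv, h⟩; exact ⟨(x, v), ⟨⟨hx, hv⟩, h⟩, rfl⟩
    · rintro ⟨⟨x, v⟩, ⟨⟨hx, hv⟩, h⟩, rfl⟩; exact ⟨hx, v, hv, h⟩
  rw [h2]; exact h1.image continuous_fst

/-- Singular boundary points. -/
def sing (K : Set (Eu n)) : Set (Eu n) :=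
  {x | x ∈ frontier K ∧ ∃ v w : Eu n, ‖v‖ = 1 ∧ ‖w‖ = 1 ∧ v ≠ w ∧ ⟪x, v⟫ = suppFun K v ∧ ⟪x, w⟫ = suppFun K w}

lemma Bod.sing_meas (hK : Bod K r R) : MeasurableSet (sing K) := by
  have h1 : ∀ k : ℕ, IsCompact ((frontier K ×ˢ (sphere (0:Eu n) 1 ×ˢ sphere (0 : Eu n) 1)) ∩
      {p : Eu n × Eu n × Eu n | ⟪p.1, p.2.1⟫ = suppFun K p.2.1 ∧ ⟪p.1, p.2.2⟫ = suppFun K p.2.2 ∧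
        1 / ((k:ℝ) + 1) ≤ ‖p.2.1 - p.2.2‖}) := by
    intro k
    refine (hK.fr_compact.prod ((isCompact_sphere _ _).prod (isCompact_sphere _ _))).inter_right ?_
    have := hK.supp_cont
    have c1 : IsClosed {p : Eu n × Eu n × Eu n | ⟪p.1, p.2.1⟫ = suppFun K p.2.1} :=
      isClosed_eq (by fun_prop) (by fun_prop)
    have c2 : IsClosed {p : Eu n × Eu n × Eu n | ⟪p.1, p.2.2⟫ = suppFun K p.2.2} :=
      isClosed_eq (by fun_prop) (by fun_prop)
    have c3 : IsClosed {p : Eu n × Eu n × Eu n | 1 / ((k:ℝ) + 1) ≤ ‖p.2.1 - p.2.2‖} :=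
      isClosed_le (by fun_prop) (by fun_prop)
    exact c1.inter (c2.inter c3)
  have h2 : sing K = ⋃ k : ℕ, Prod.fst '' ((frontier K ×ˢ (sphere (0:Eu n) 1 ×ˢ sphere (0 : Eu n) 1)) ∩
      {p : Eu n × Eu n × Eu n | ⟪p.1, p.2.1⟫ = suppFun K p.2.1 ∧ ⟪p.1, p.2.2⟫ = suppFun K p.2.2 ∧
        1 / ((k:ℝ) + 1) ≤ ‖p.2.1 - p.2.2‖}) := by
    ext x; rw [mem_iUnion]; constructor
    · rintro ⟨hx, v, w, hv, hw, hvw, h1, h2⟩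
      obtain ⟨k, hk⟩ := exists_nat_one_div_lt (norm_pos_iff.2 (sub_ne_zero.2 hvw))
      exact ⟨k, (x, v, w), ⟨⟨hx, by simpa using hv, by simpa using hw⟩, h1, h2, hk.le⟩, rfl⟩
    · rintro ⟨k, ⟨x, v, w⟩, ⟨⟨hx, hv, hw⟩, h1, h2, hk⟩, rfl⟩
      refine ⟨hx, v, w, by simpa using hv, by simpa using hw, ?_, h1, h2⟩
      have : (0:ℝ) < 1 / ((k:ℝ) + 1) := by positivity
      exact sub_ne_zero.1 (norm_pos_iff.1 (this.trans_le hk))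
  rw [h2]
  exact MeasurableSet.iUnion fun k => ((h1 k).image continuous_fst).isClosed.measurableSet

lemma Bod.sing_cone_null (hK : Bod K r R) : volume (cone (sing K)) = 0 := by
  have hae := hK.gauge_lip.ae_differentiableAt (μ := (volume : Measure (Eu n)))
  refine measure_mono_null ?_ hae
  rintro _ ⟨s, hs, x, ⟨hx, v, w, hv, hw, hvw, h1, h2⟩, rfl⟩ hd
  have key : ∀ v : Eu n, ‖v‖ = 1 → ⟪x, v⟫ = suppFun K v →
      fderiv ℝ (gauge K) (s • x) = (suppFun K v)⁻¹ • innerSL ℝ v := by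
    intro v hv h
    have hp := hK.supp_pos hv
    have hmin : IsLocalMin (fun z => gauge K z - (suppFun K v)⁻¹ * ⟪v, z⟫) (s • x) := by
      refine Filter.Eventually.of_forall fun z => ?_
      have a : gauge K (s • x) - (suppFun K v)⁻¹ * ⟪v, s • x⟫ = 0 := by
        rw [gauge_sm hs.1.le, hK.gauge_fr.2 hx, real_inner_smul_right, real_inner_comm, h]
        field_simp; ring
      have b := hK.inner_le_gauge z v
      simp only [a]
      rw [real_inner_comm, ← div_eq_inv_mul, sub_nonneg, div_le_iff₀ hp]; exact b
    have hd2 : HasFDerivAt (fun z => gauge K z - (suppFun K v)⁻¹ * ⟪v, z⟫)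
        (fderiv ℝ (gauge K) (s • x) - (suppFun K v)⁻¹ • innerSL ℝ v) (s • x) := by
      have := ((innerSL ℝ v).hasFDerivAt (x := s • x)).const_mul (suppFun K v)⁻¹
      exact HasFDerivAt.sub (DifferentiableAt.hasFDerivAt hd) this
    exact sub_eq_zero.1 (hmin.hasFDerivAt_eq_zero hd2)
  have e := (key v hv h1).symm.trans (key w hw h2)
  have e2 : (suppFun K v)⁻¹ • v = (suppFun K w)⁻¹ • w := by
    apply ext_inner_right ℝ
    intro z
    have := congrArg (fun f => f z) e
    simpa [real_inner_smul_left] using this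
  have e3 := congrArg norm e2
  have pv := hK.supp_pos hv
  have pw := hK.supp_pos hw
  rw [norm_smul, norm_smul, hv, hw, mul_one, mul_one, Real.norm_of_nonneg (by positivity),
    Real.norm_of_nonneg (by positivity)] at e3
  rw [e3] at e2
  exact hvw (smul_right_injective _ (by positivity : (suppFun K w)⁻¹ ≠ 0) e2)

lemma exists_cover (n : ℕ) {ε : ℝ} (hε : 0 < ε) : ∃ (N : ℕ) (u : Fin N → Eu n), (∀ i, ‖u i‖ = 1) ∧
    ∀ v : Eu n, ‖v‖ = 1 → ∃ i, ‖v - u i‖ ≤ ε := by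
  obtain ⟨t, hts, htf, hc⟩ := (isCompact_sphere (0 : Eu n) 1).finite_cover_balls hε
  let e := htf.toFinset.equivFin
  refine ⟨_, fun i => (e.symm i : Eu n), fun i => ?_, fun v hv => ?_⟩
  · have := hts (htf.mem_toFinset.1 (e.symm i).2); simpa using this
  · have : v ∈ sphere (0 : Eu n) 1 := by simpa using hv
    have := hc this
    simp only [mem_iUnion] at this
    obtain ⟨x, hx, hvx⟩ := this
    refine ⟨e ⟨x, htf.mem_toFinset.2 hx⟩, ?_⟩
    simp only [Equiv.symm_apply_apply]
    rw [mem_ball, dist_eq_norm] at hvx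
    exact hvx.le

lemma Bod.sing_null (hn : 2 ≤ n) (hK : Bod K r R) : μH[(n:ℝ) - 1] (sing K) = 0 := by
  obtain ⟨c, hc, H⟩ := cone_comp hn (A := 2) (by norm_num)
  have hp : 0 < R / r + 1 := by have := hK.rpos; have := hK.Rnn; positivity
  obtain ⟨N, u, hu, hcov⟩ := exists_cover n (div_pos hc hp)
  have hsub : sing K ⊆ ⋃ i, sing K ∩ Eset K (cap (u i) (c / (R / r + 1))) := by
    intro x hx
    obtain ⟨hxf, v, w, hv, _, _, h, _⟩ := id hx
    obtain ⟨i, hi⟩ := hcov v hv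
    exact mem_iUnion.2 ⟨i, hx, hxf, v, ⟨hv, hi⟩, h⟩
  refine measure_mono_null hsub (measure_iUnion_null fun i => ?_)
  have h2 := (H K r R (c / (R / r + 1)) hK (by rw [div_mul_cancel₀ _ hp.ne']) (u i) (hu i)
    (sing K ∩ Eset K (cap (u i) (c / (R / r + 1))))
    (hK.sing_meas.inter (hK.Eset_compact (cap_compact _ _)).isClosed.measurableSet)
    ⟨fun x hx => hx.1.1, fun x hx => by
      obtain ⟨_, v, ⟨h1, h2⟩, h3⟩ := hx.2; exact ⟨v, h1, h2, h3⟩⟩).2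
  have h3 : volume (cone (sing K ∩ Eset K (cap (u i) (c / (R / r + 1))))) = 0 := by
    refine measure_mono_null ?_ hK.sing_cone_null
    rintro _ ⟨s, hs, x, hx, rfl⟩
    exact ⟨s, hs, x, hx.1, rfl⟩
  rw [h3, mul_zero, nonpos_iff_eq_zero, mul_eq_zero, mul_eq_zero] at h2
  rcases h2 with (h | h) | h
  · exact absurd (by exact_mod_cast h) (kap_ne hn)
  · rw [ENNReal.ofReal_eq_zero] at h
    exact absurd h (not_le.2 (hK.supp_pos (hu i)))
  · exact h

end

/-- Gaussian weighted surface measure. -/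
def Sm (n : ℕ) (F : Set (Eu n)) : ℝ :=
  (Real.sqrt (2 * Real.pi))⁻¹ ^ n * ∫ x in F, Real.exp (-‖x‖ ^ 2 / 2) ∂μH[(n : ℝ) - 1]

lemma exp_intOn {n : ℕ} {μ : Measure (Eu n)} {B : Set (Eu n)} (hf : μ B < ∞) :
    IntegrableOn (fun x : Eu n => Real.exp (-‖x‖ ^ 2 / 2)) B μ := by
  have hc : Continuous fun x : Eu n => Real.exp (-‖x‖ ^ 2 / 2) := by fun_prop
  refine Measure.integrableOn_of_bounded (M := 1) hf.ne hc.aestronglyMeasurable (ae_of_all _ fun x => ?_)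
  rw [Real.norm_eq_abs, abs_of_pos (Real.exp_pos _), Real.exp_le_one_iff]
  have : 0 ≤ ‖x‖ ^ 2 := by positivity
  linarith

lemma exp_upper {n : ℕ} {μ : Measure (Eu n)} {B : Set (Eu n)} (hB : MeasurableSet B) (hf : μ B < ∞)
    {a : ℝ} (ha : 0 ≤ a) (h : ∀ x ∈ B, a ≤ ‖x‖) :
    ∫ x in B, Real.exp (-‖x‖ ^ 2 / 2) ∂μ ≤ Real.exp (-a ^ 2 / 2) * μ.real B := by
  have := setIntegral_mono_on (exp_intOn hf) (integrableOn_const (C := Real.exp (-a ^ 2 / 2)) hf.ne) hB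
    (fun x hx => by
      have : a ^ 2 ≤ ‖x‖ ^ 2 := by gcongr; exact h x hx
      gcongr)
  simpa [mul_comm] using this

lemma exp_lower {n : ℕ} {μ : Measure (Eu n)} {B : Set (Eu n)} (hB : MeasurableSet B) (hf : μ B < ∞)
    {a : ℝ} (h : ∀ x ∈ B, ‖x‖ ≤ a) :
    Real.exp (-a ^ 2 / 2) * μ.real B ≤ ∫ x in B, Real.exp (-‖x‖ ^ 2 / 2) ∂μ := by
  have := setIntegral_mono_on (integrableOn_const (C := Real.exp (-a ^ 2 / 2)) hf.ne) (exp_intOn hf) hB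
    (fun x hx => by
      have : ‖x‖ ^ 2 ≤ a ^ 2 := by gcongr; exact h x hx
      gcongr)
  simpa [mul_comm] using this

lemma Sm_nonneg (n : ℕ) (F : Set (Eu n)) : 0 ≤ Sm n F := by
  unfold Sm
  have : 0 ≤ ∫ x in F, Real.exp (-‖x‖ ^ 2 / 2) ∂μH[(n : ℝ) - 1] :=
    integral_nonneg fun x => (Real.exp_pos _).le
  positivity

/-- Partition of the sphere. -/
def etaP {n N : ℕ} (ε : ℝ) (u : Fin N → Eu n) (i : Fin N) : Set (Eu n) :=
  cap (u i) ε \ ⋃ j, ⋃ (_ : j < i), cap (u j) ε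

/-- Partition of the boundary. -/
def Dp {n N : ℕ} (K : Set (Eu n)) (ε : ℝ) (u : Fin N → Eu n) (i : Fin N) : Set (Eu n) :=
  Eset K (cap (u i) ε) \ ⋃ j, ⋃ (_ : j < i), Eset K (cap (u j) ε)

lemma etaP_meas {n N : ℕ} (ε : ℝ) (u : Fin N → Eu n) (i : Fin N) : MeasurableSet (etaP ε u i) :=
  (cap_compact _ _).isClosed.measurableSet.diff
    (MeasurableSet.iUnion fun j => MeasurableSet.iUnion fun _ => (cap_compact _ _).isClosed.measurableSet)

lemma etaP_sub {n N : ℕ} (ε : ℝ) (u : Fin N → Eu n) (i : Fin N) : etaP ε u i ⊆ sphere (0 : Eu n) 1 :=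
  fun v hv => by simpa using hv.1.1

section
variable {n : ℕ} {K : Set (Eu n)} {r R : ℝ}

lemma Dp_meas (hK : Bod K r R) {N : ℕ} (ε : ℝ) (u : Fin N → Eu n) (i : Fin N) :
    MeasurableSet (Dp K ε u i) :=
  (hK.Eset_compact (cap_compact _ _)).isClosed.measurableSet.diff
    (MeasurableSet.iUnion fun j => MeasurableSet.iUnion fun _ =>
      (hK.Eset_compact (cap_compact _ _)).isClosed.measurableSet)

lemma Dp_fr {N : ℕ} (ε : ℝ) (u : Fin N → Eu n) (i : Fin N) : Dp K ε u i ⊆ frontier K :=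
  fun x hx => hx.1.1

lemma Dp_near {N : ℕ} (ε : ℝ) (u : Fin N → Eu n) (i : Fin N) : NearN K ε (u i) (Dp K ε u i) :=
  ⟨Dp_fr ε u i, fun x hx => by obtain ⟨_, v, ⟨h1, h2⟩, h3⟩ := hx.1; exact ⟨v, h1, h2, h3⟩⟩

lemma Dp_disj {N : ℕ} (ε : ℝ) (u : Fin N → Eu n) : Pairwise (fun i j => Disjoint (Dp K ε u i) (Dp K ε u j)) := by
  have key : ∀ i j : Fin N, i < j → Disjoint (Dp K ε u i) (Dp K ε u j) := by
    intro i j hij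
    rw [Set.disjoint_left]
    intro x hx hx2
    apply hx2.2
    simp only [mem_iUnion]
    exact ⟨i, hij, hx.1⟩
  intro i j hij
  rcases lt_or_gt_of_ne hij with h | h
  · exact key i j h
  · exact (key j i h).symm

lemma Dp_union (hK : Bod K r R) {N : ℕ} {ε : ℝ} {u : Fin N → Eu n}
    (hu : ∀ v : Eu n, ‖v‖ = 1 → ∃ i, ‖v - u i‖ ≤ ε) {x : Eu n} (hx : x ∈ frontier K) :
    ∃ i, x ∈ Dp K ε u i := by
  classical
  obtain ⟨v, hv, hxv⟩ := hK.exists_normal hx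
  obtain ⟨i, hi⟩ := hu v hv
  have hne : ∃ i : ℕ, ∃ h : i < N, x ∈ Eset K (cap (u ⟨i, h⟩) ε) :=
    ⟨i, i.2, hx, v, ⟨hv, hi⟩, hxv⟩
  obtain ⟨h, hm⟩ := Nat.find_spec hne
  refine ⟨⟨Nat.find hne, h⟩, hm, ?_⟩
  simp only [mem_iUnion, not_exists]
  intro j hj hxj
  exact Nat.find_min hne hj ⟨j.2, hxj⟩

lemma cone_sub (hK : Bod K r R) {F : Set (Eu n)} (hF : F ⊆ frontier K) : cone F ⊆ K := by
  rintro _ ⟨s, hs, x, hx, rfl⟩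
  rw [← hK.gauge_le_one, gauge_sm hs.1.le, hK.gauge_fr.2 (hF hx), mul_one]
  exact hs.2

lemma fr_ne (hK : Bod K r R) {x : Eu n} (hx : x ∈ frontier K) : x ≠ 0 := by
  rintro rfl
  have := hK.gauge_fr.2 hx
  simp at this

lemma cone_eq (hK : Bod K r R) {F : Set (Eu n)} (hF : F ⊆ frontier K) :
    cone F = {z | z ≠ 0 ∧ gauge K z ≤ 1 ∧ (gauge K z)⁻¹ • z ∈ F} := by
  ext z; constructor
  · rintro ⟨s, hs, x, hx, rfl⟩
    have e : gauge K (s • x) = s := by rw [gauge_sm hs.1.le, hK.gauge_fr.2 (hF hx), mul_one]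
    refine ⟨smul_ne_zero hs.1.ne' (fr_ne hK (hF hx)), by rw [e]; exact hs.2, ?_⟩
    rw [e, smul_smul, inv_mul_cancel₀ hs.1.ne', one_smul]; exact hx
  · rintro ⟨h0, h1, h2⟩
    have hp := hK.gauge_pos h0
    refine ⟨gauge K z, ⟨hp, h1⟩, _, h2, ?_⟩
    rw [smul_smul, mul_inv_cancel₀ hp.ne', one_smul]

lemma cone_meas (hK : Bod K r R) {F : Set (Eu n)} (hF : F ⊆ frontier K) (hm : MeasurableSet F) :
    MeasurableSet (cone F) := by
  rw [cone_eq hK hF]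
  have hg : Measurable (gauge K) := hK.gauge_lip.continuous.measurable
  have h1 : MeasurableSet {z : Eu n | z ≠ 0} := (measurableSet_singleton (0 : Eu n)).compl
  have h2 : MeasurableSet {z : Eu n | gauge K z ≤ 1} := hg measurableSet_Iic
  have h3 : Measurable fun z : Eu n => (gauge K z)⁻¹ • z := hg.inv.smul measurable_id
  exact h1.inter (h2.inter (h3 hm))

lemma cone_disj (hK : Bod K r R) {F G : Set (Eu n)} (hF : F ⊆ frontier K) (hG : G ⊆ frontier K)
    (h : Disjoint F G) : Disjoint (cone F) (cone G) := by
  rw [cone_eq hK hF, cone_eq hK hG, Set.disjoint_left]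
  rintro z ⟨_, _, h1⟩ ⟨_, _, h2⟩
  exact Set.disjoint_left.1 h h1 h2

lemma cone_fin (hK : Bod K r R) {F : Set (Eu n)} (hF : F ⊆ frontier K) : volume (cone F) < ∞ :=
  (measure_mono (cone_sub hK hF)).trans_lt hK.comp.measure_lt_top

lemma near_fin (hn : 2 ≤ n) (hK : Bod K r R) {A : ℝ≥0} {u : Eu n} (hu : ‖u‖ = 1) {F : Set (Eu n)}
    (hF : F ⊆ frontier K)
    (h : kap n * ENNReal.ofReal (suppFun K u) * μH[(n:ℝ)-1] F ≤ A * volume (cone F)) :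
    μH[(n:ℝ)-1] F < ∞ := by
  have h1 : kap n * ENNReal.ofReal (suppFun K u) * μH[(n:ℝ)-1] F < ∞ :=
    h.trans_lt (ENNReal.mul_lt_top ENNReal.coe_lt_top (cone_fin hK hF))
  rcases ENNReal.mul_lt_top_iff.1 h1 with h | h | h
  · exact h.2
  · exfalso
    rw [mul_eq_zero] at h
    rcases h with h | h
    · exact kap_ne hn (by exact_mod_cast h)
    · rw [ENNReal.ofReal_eq_zero] at h
      exact absurd h (not_le.2 (hK.supp_pos hu))
  · rw [h]; exact ENNReal.zero_lt_top

lemma fr_fin (hn : 2 ≤ n) (hK : Bod K r R) : μH[(n:ℝ)-1] (frontier K) < ∞ := by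
  obtain ⟨c, hc, H⟩ := cone_comp hn (A := 2) (by norm_num)
  have hp : 0 < R / r + 1 := by
    have := hK.Rnn; have := hK.rpos; positivity
  obtain ⟨N, u, hu, hcov⟩ := exists_cover n (ε := c / (R / r + 1)) (by positivity)
  have hs : frontier K ⊆ ⋃ i, Dp K (c / (R / r + 1)) u i := fun x hx => by
    rw [mem_iUnion]; exact Dp_union hK hcov hx
  refine (measure_mono hs).trans_lt ((measure_iUnion_le _).trans_lt ?_)
  rw [tsum_fintype]
  refine ENNReal.sum_lt_top.2 fun i _ => ?_
  exact near_fin hn hK (hu i) (Dp_fr _ _ _) (H K r R _ hK (by rw [div_mul_cancel₀ _ hp.ne']) (u i) (hu i) _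
    (Dp_meas hK _ _ _) (Dp_near _ _ _)).2

lemma Dp_surf (hn : 2 ≤ n) (hK : Bod K r R) {N : ℕ} (ε : ℝ) (u : Fin N → Eu n) (i : Fin N) :
    gaussSurf n K (etaP ε u i) = Sm n (Dp K ε u i) := by
  have h1 : Dp K ε u i ⊆ Eset K (etaP ε u i) := by
    rintro x ⟨⟨hx, v, hv, h⟩, h2⟩
    refine ⟨hx, v, ⟨hv, fun hc => h2 ?_⟩, h⟩
    simp only [mem_iUnion] at hc ⊢
    obtain ⟨j, hj, hvj⟩ := hc
    exact ⟨j, hj, hx, v, hvj, h⟩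
  have h2 : Eset K (etaP ε u i) ⊆ Dp K ε u i ∪ sing K := by
    rintro x ⟨hx, v, ⟨hv, hv2⟩, h⟩
    by_cases hs : x ∈ sing K
    · exact Or.inr hs
    refine Or.inl ⟨⟨hx, v, hv, h⟩, fun hc => hs ?_⟩
    simp only [mem_iUnion] at hc hv2
    obtain ⟨j, hj, _, w, hw, hxw⟩ := hc
    refine ⟨hx, v, w, hv.1, hw.1, ?_, h, hxw⟩
    rintro rfl
    exact hv2 ⟨j, hj, hw⟩
  have h3 : Eset K (etaP ε u i) =ᵐ[μH[(n:ℝ)-1]] Dp K ε u i := by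
    refine ((ae_le_set.2 ?_).antisymm (HasSubset.Subset.eventuallyLE h1))
    refine measure_mono_null ?_ (hK.sing_null hn)
    rintro x ⟨hx, hx2⟩
    exact (h2 hx).resolve_left hx2
  unfold gaussSurf Sm
  congr 1
  exact setIntegral_congr_set h3

end

section
variable {n : ℕ} {K : Set (Eu n)} {r R : ℝ}

lemma gE_upper {B : Set (Eu n)} (hB : MeasurableSet B) (hf : volume B < ∞)
    {a : ℝ} (ha : 0 ≤ a) (h : ∀ x ∈ B, a ≤ ‖x‖) :
    (gE n).real B ≤ (Real.sqrt (2 * Real.pi))⁻¹ ^ n * (Real.exp (-a ^ 2 / 2) * volume.real B) := by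
  rw [← gaussVol_eq n hB, gaussVol]
  exact mul_le_mul_of_nonneg_left (exp_upper hB hf ha h) (by positivity)

lemma gE_lower {B : Set (Eu n)} (hB : MeasurableSet B) (hf : volume B < ∞)
    {a : ℝ} (h : ∀ x ∈ B, ‖x‖ ≤ a) :
    (Real.sqrt (2 * Real.pi))⁻¹ ^ n * (Real.exp (-a ^ 2 / 2) * volume.real B) ≤ (gE n).real B := by
  rw [← gaussVol_eq n hB, gaussVol]
  exact mul_le_mul_of_nonneg_left (exp_lower hB hf h) (by positivity)

lemma vol_smul {q : ℝ} (hq : 0 < q) (B : Set (Eu n)) : volume.real (q • B) = q ^ n * volume.real B := by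
  rw [measureReal_def, Measure.addHaar_smul]
  simp [measureReal_def, abs_of_pos (pow_pos hq n), hq.le]

lemma shell_geo (hK : Bod K r R) {F : Set (Eu n)} (hF : F ⊆ frontier K) (hm : MeasurableSet F)
    {a b : ℝ} (ha : 0 ≤ a) (hFa : ∀ x ∈ F, a ≤ ‖x‖) (hFb : ∀ x ∈ F, ‖x‖ ≤ b) {q : ℝ} (hq : 0 < q) :
    (1 ≤ q → (gE n).real (q • cone F) - (gE n).real (cone F) ≤
      (q ^ n - 1) * ((Real.sqrt (2 * Real.pi))⁻¹ ^ n * (Real.exp (-a ^ 2 / 2) * volume.real (cone F)))) ∧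
    (q ≤ 1 → (gE n).real (q • cone F) - (gE n).real (cone F) ≤
      (q ^ n - 1) * ((Real.sqrt (2 * Real.pi))⁻¹ ^ n * (Real.exp (-b ^ 2 / 2) * volume.real (cone F)))) := by
  have hc := cone_meas hK hF hm
  have hqc : MeasurableSet (q • cone F) := hc.const_smul₀ q
  have hfin := cone_fin hK hF
  have hqfin : volume (q • cone F) < ∞ := by
    rw [Measure.addHaar_smul]; exact ENNReal.mul_lt_top ENNReal.ofReal_lt_top hfin
  constructor
  · intro h1
    have hsub : cone F ⊆ q • cone F := by
      rintro _ ⟨s, hs, x, hx, rfl⟩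
      refine ⟨(s / q) • x, ⟨s / q, ⟨by have := hs.1; positivity, ?_⟩, x, hx, rfl⟩, ?_⟩
      · rw [div_le_one hq]; exact hs.2.trans h1
      · simp only [smul_smul]; rw [mul_div_cancel₀ _ hq.ne']
    rw [← measureReal_sdiff hsub hc]
    refine (gE_upper (hqc.diff hc) ((measure_mono sdiff_subset).trans_lt hqfin) ha ?_).trans (le_of_eq ?_)
    · rintro _ ⟨⟨_, ⟨s, hs, x, hx, rfl⟩, rfl⟩, h2⟩
      simp only [smul_smul] at h2 ⊢
      have h3 : 1 < q * s := by
        by_contra hcon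
        exact h2 ⟨q * s, ⟨mul_pos hq hs.1, not_lt.1 hcon⟩, x, hx, rfl⟩
      rw [norm_smul, Real.norm_eq_abs, abs_of_pos (by linarith)]
      have := hFa x hx
      nlinarith [norm_nonneg x]
    · rw [measureReal_sdiff hsub hc (h₁ := hqfin.ne), vol_smul hq]; ring
  · intro h1
    have hsub : q • cone F ⊆ cone F := by
      rintro _ ⟨_, ⟨s, hs, x, hx, rfl⟩, rfl⟩
      refine ⟨q * s, ⟨mul_pos hq hs.1, ?_⟩, x, hx, by simp [smul_smul]⟩
      have := hs.2; have := hs.1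
      nlinarith
    have e := measureReal_sdiff hsub hqc (μ := gE n)
    have := gE_lower (hc.diff hqc) ((measure_mono sdiff_subset).trans_lt hfin) (a := b) (by
      rintro _ ⟨⟨s, hs, x, hx, rfl⟩, -⟩
      rw [norm_smul, Real.norm_eq_abs, abs_of_pos hs.1]
      have := hFb x hx
      have := hs.2
      nlinarith [norm_nonneg x])
    rw [measureReal_sdiff hsub hqc (h₁ := hfin.ne), vol_smul hq, e] at this
    linarith

lemma shell (hn : 2 ≤ n) (hK : Bod K r R) {A : ℝ≥0} (hA : 1 < A) {u : Eu n} (hu : ‖u‖ = 1)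
    {F : Set (Eu n)} (hF : F ⊆ frontier K) (hm : MeasurableSet F)
    (hc1 : volume (cone F) ≤ A * (kap n * ENNReal.ofReal (suppFun K u) * μH[(n:ℝ)-1] F))
    (hc2 : kap n * ENNReal.ofReal (suppFun K u) * μH[(n:ℝ)-1] F ≤ A * volume (cone F))
    {a b : ℝ} (ha : 0 ≤ a) (hFa : ∀ x ∈ F, a ≤ ‖x‖) (hFb : ∀ x ∈ F, ‖x‖ ≤ b)
    (hab : Real.exp (-a ^ 2 / 2) ≤ A * Real.exp (-b ^ 2 / 2)) {q : ℝ} (hq : 0 < q) :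
    (gE n).real (q • cone F) - (gE n).real (cone F) ≤
      ((q ^ n - 1) + ((A:ℝ) ^ 2 - 1) * |q ^ n - 1|) * (kap n * suppFun K u * Sm n F) := by
  have hHfin := near_fin hn hK hu hF hc2
  have hsp := hK.supp_pos hu
  set V := volume.real (cone F) with hV
  set H := (μH[(n:ℝ)-1] : Measure (Eu n)).real F with hH
  set κ : ℝ := kap n * suppFun K u with hκ
  have hκ0 : 0 ≤ κ := by positivity
  have hA1 : (1:ℝ) < A := by exact_mod_cast hA
  have r1 : V ≤ A * (κ * H) := by
    have := ENNReal.toReal_mono (by finiteness) hc1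
    simpa [ENNReal.toReal_mul, hsp.le, hV, hH, hκ, measureReal_def] using this
  have r2 : κ * H ≤ A * V := by
    have := ENNReal.toReal_mono (ENNReal.mul_ne_top (by finiteness) (cone_fin hK hF).ne) hc2
    simpa [ENNReal.toReal_mul, hsp.le, hV, hH, hκ, measureReal_def] using this
  set c : ℝ := (Real.sqrt (2 * Real.pi))⁻¹ ^ n with hc
  have hcp : 0 ≤ c := by positivity
  have s1 : Sm n F ≤ c * (Real.exp (-a ^ 2 / 2) * H) :=
    mul_le_mul_of_nonneg_left (exp_upper hm hHfin ha hFa) hcp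
  have s2 : c * (Real.exp (-b ^ 2 / 2) * H) ≤ Sm n F :=
    mul_le_mul_of_nonneg_left (exp_lower hm hHfin hFb) hcp
  obtain ⟨g1, g2⟩ := shell_geo hK hF hm ha hFa hFb hq
  have hVn : 0 ≤ V := measureReal_nonneg
  have hHn : 0 ≤ H := measureReal_nonneg
  have hS := Sm_nonneg n F
  have hea := Real.exp_pos (-a ^ 2 / 2)
  have heb := Real.exp_pos (-b ^ 2 / 2)
  set ea := Real.exp (-a ^ 2 / 2)
  set eb := Real.exp (-b ^ 2 / 2)
  have k1 : c * (ea * V) ≤ A ^ 2 * (κ * Sm n F) := by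
    calc c * (ea * V) ≤ c * ((A * eb) * (A * (κ * H))) := by gcongr
      _ = A ^ 2 * (κ * (c * (eb * H))) := by ring
      _ ≤ _ := by gcongr
  have k2 : κ * Sm n F ≤ A ^ 2 * (c * (eb * V)) := by
    calc κ * Sm n F ≤ κ * (c * (ea * H)) := by gcongr
      _ = c * (ea * (κ * H)) := by ring
      _ ≤ c * ((A * eb) * (A * V)) := by gcongr
      _ = _ := by ring
  rcases le_total 1 q with h | h
  · have hp : 0 ≤ q ^ n - 1 := by linarith [one_le_pow₀ h (n := n)]
    refine (g1 h).trans ?_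
    rw [abs_of_nonneg hp]
    calc (q ^ n - 1) * (c * (ea * V)) ≤ (q ^ n - 1) * (A ^ 2 * (κ * Sm n F)) := by gcongr
      _ = _ := by ring
  · have hp : q ^ n - 1 ≤ 0 := by linarith [pow_le_one₀ hq.le h (n := n)]
    refine (g2 h).trans ?_
    rw [abs_of_nonpos hp]
    have hX : 0 ≤ c * (eb * V) := by positivity
    have hY : 0 ≤ κ * Sm n F := by positivity
    have k3 : (2 - (A:ℝ) ^ 2) * (κ * Sm n F) ≤ c * (eb * V) := by
      rcases le_total (2 - (A:ℝ)^2) 0 with h0 | h0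
      · nlinarith
      · have : (2 - (A:ℝ)^2) * (A:ℝ)^2 ≤ 1 := by nlinarith [sq_nonneg ((A:ℝ)^2 - 1)]
        calc (2 - (A:ℝ) ^ 2) * (κ * Sm n F) ≤ (2 - (A:ℝ) ^ 2) * (A ^ 2 * (c * (eb * V))) := by gcongr
          _ = ((2 - (A:ℝ)^2) * (A:ℝ)^2) * (c * (eb * V)) := by ring
          _ ≤ 1 * (c * (eb * V)) := by gcongr
          _ = _ := one_mul _
    nlinarith

/-- Annuli. -/
lemma exists_annuli {A : ℝ≥0} (hA : 1 < A) (R : ℝ) : ∃ ρ : ℝ, 0 < ρ ∧ ∀ a : ℝ, 0 ≤ a → a ≤ R →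
    Real.exp (-a ^ 2 / 2) ≤ A * Real.exp (-(a + ρ) ^ 2 / 2) := by
  have hA1 : (1:ℝ) < A := by exact_mod_cast hA
  have hl := Real.log_pos hA1
  have h1 : Tendsto (fun ρ : ℝ => (2 * R * ρ + ρ ^ 2) / 2) (𝓝[>] 0) (𝓝 0) := by
    have : Continuous fun ρ : ℝ => (2 * R * ρ + ρ ^ 2) / 2 := by fun_prop
    simpa using (this.tendsto 0).mono_left nhdsWithin_le_nhds
  obtain ⟨ρ, h2, hρ⟩ := ((h1.eventually (gt_mem_nhds hl)).and self_mem_nhdsWithin).exists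
  have hρ : 0 < ρ := hρ
  refine ⟨ρ, hρ, fun a ha haR => ?_⟩
  rw [← Real.exp_log (zero_lt_one.trans hA1), ← Real.exp_add, Real.exp_le_exp]
  nlinarith [mul_le_mul_of_nonneg_right haR hρ.le]

lemma shell_all (hn : 2 ≤ n) (hK : Bod K r R) {A : ℝ≥0} (hA : 1 < A) {u : Eu n} (hu : ‖u‖ = 1)
    {D : Set (Eu n)} (hD : D ⊆ frontier K) (hm : MeasurableSet D)
    (hc : ∀ F ⊆ D, MeasurableSet F →
      volume (cone F) ≤ A * (kap n * ENNReal.ofReal (suppFun K u) * μH[(n:ℝ)-1] F) ∧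
      kap n * ENNReal.ofReal (suppFun K u) * μH[(n:ℝ)-1] F ≤ A * volume (cone F)) {q : ℝ} (hq : 0 < q) :
    (gE n).real (q • cone D) - (gE n).real (cone D) ≤
      ((q ^ n - 1) + ((A:ℝ) ^ 2 - 1) * |q ^ n - 1|) * (kap n * suppFun K u * Sm n D) := by
  obtain ⟨ρ, hρ, H⟩ := exists_annuli hA R
  let M := ⌊R / ρ⌋₊ + 1
  let P : Fin M → Set (Eu n) := fun j => D ∩ {x | ⌊‖x‖ / ρ⌋₊ = (j:ℕ)}
  have hPm : ∀ j, MeasurableSet (P j) := fun j => by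
    refine hm.inter ?_
    have : Measurable fun x : Eu n => ⌊‖x‖ / ρ⌋₊ := Nat.measurable_floor.comp (by fun_prop)
    exact this (measurableSet_singleton _)
  have hPd : Pairwise (fun i j => Disjoint (P i) (P j)) := by
    intro i j hij
    rw [Set.disjoint_left]
    rintro x ⟨_, h1⟩ ⟨_, h2⟩
    exact hij (Fin.ext (h1.symm.trans h2))
  have hPs : ∀ j, P j ⊆ D := fun j => inter_subset_left
  have hPu : D = ⋃ j, P j := by
    refine Subset.antisymm (fun x hx => ?_) (iUnion_subset hPs)
    have : ⌊‖x‖ / ρ⌋₊ < M := by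
      refine Nat.lt_succ_of_le (Nat.floor_mono ?_)
      have := hK.norm_le (hK.fr_sub (hD hx))
      gcongr
    exact mem_iUnion.2 ⟨⟨_, this⟩, hx, rfl⟩
  have hcu : cone D = ⋃ j, cone (P j) := by
    ext z; rw [mem_iUnion]; constructor
    · rintro ⟨s, hs, x, hx, rfl⟩
      rw [hPu, mem_iUnion] at hx
      obtain ⟨j, hj⟩ := hx
      exact ⟨j, s, hs, x, hj, rfl⟩
    · rintro ⟨j, s, hs, x, hx, rfl⟩; exact ⟨s, hs, x, hPs j hx, rfl⟩
  have hPfr : ∀ j, P j ⊆ frontier K := fun j => (hPs j).trans hD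
  have hcd : Pairwise (fun i j => Disjoint (cone (P i)) (cone (P j))) := fun i j hij =>
    cone_disj hK (hPfr i) (hPfr j) (hPd hij)
  have hcm : ∀ j, MeasurableSet (cone (P j)) := fun j => cone_meas hK (hPfr j) (hPm j)
  have e1 : (gE n).real (cone D) = ∑ j, (gE n).real (cone (P j)) := by
    rw [hcu, measureReal_iUnion_fintype hcd hcm]
  have e2 : (gE n).real (q • cone D) = ∑ j, (gE n).real (q • cone (P j)) := by
    rw [hcu, smul_set_iUnion, measureReal_iUnion_fintype (fun i j hij => ?_) fun j => (hcm j).const_smul₀ q]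
    exact (Set.disjoint_image_iff (smul_right_injective _ hq.ne')).2 (hcd hij)
  have e3 : Sm n D = ∑ j, Sm n (P j) := by
    unfold Sm
    rw [← Finset.mul_sum]
    congr 1
    conv_lhs => rw [hPu]
    exact integral_iUnion_fintype hPm hPd fun j => exp_intOn
      (near_fin hn hK hu (hPfr j) (hc _ (hPs j) (hPm j)).2)
  rw [e1, e2, e3, ← Finset.sum_sub_distrib, Finset.mul_sum, Finset.mul_sum]
  refine Finset.sum_le_sum fun j _ => ?_
  obtain ⟨c1, c2⟩ := hc _ (hPs j) (hPm j)
  rcases (P j).eq_empty_or_nonempty with h | ⟨y, hy⟩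
  · have : cone (∅ : Set (Eu n)) = ∅ := by ext; simp [cone]
    simp [h, this, Sm]
  have hj : ρ * (j:ℕ) ≤ ‖y‖ := by
    have : ((⌊‖y‖ / ρ⌋₊ : ℕ) : ℝ) ≤ ‖y‖ / ρ := Nat.floor_le (by positivity)
    rw [hy.2, le_div_iff₀ hρ] at this; linarith
  have hyR := hK.norm_le (hK.fr_sub (hPfr j hy))
  refine shell hn hK hA hu (hPfr j) (hPm j) c1 c2 (a := ρ * (j:ℕ)) (b := ρ * (j:ℕ) + ρ) (by positivity) ?_ ?_
    (H _ (by positivity) (hj.trans hyR)) hq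
  · rintro x ⟨_, hx⟩
    have : ((⌊‖x‖ / ρ⌋₊ : ℕ) : ℝ) ≤ ‖x‖ / ρ := Nat.floor_le (by positivity)
    rw [hx, le_div_iff₀ hρ] at this; linarith
  · rintro x ⟨_, hx⟩
    have : ‖x‖ / ρ < ((⌊‖x‖ / ρ⌋₊ : ℕ) : ℝ) + 1 := Nat.lt_floor_add_one _
    rw [hx, div_lt_iff₀ hρ] at this; linarith

end

section
variable {n : ℕ} {K L : Set (Eu n)} {r R : ℝ}

/-- Upper bound for the relative displacement on a boundary piece. -/
def bnd (K L : Set (Eu n)) (δ : ℝ) (u : Eu n) : ℝ := suppFun L u / suppFun K u - 1 + δ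

lemma ratio_var (hK : Bod K r R) (hL : Bod L r R) {ε : ℝ} {u v : Eu n} (hu : ‖u‖ = 1) (hv : ‖v‖ = 1)
    (h : ‖v - u‖ ≤ ε) :
    suppFun L v / suppFun K v ≤ suppFun L u / suppFun K u + (R / r + R ^ 2 / r ^ 2) * ε := by
  have hr := hK.rpos
  have hR := hK.Rnn
  have h1 : suppFun L v ≤ suppFun L u + R * ε := by
    have := hL.supp_sub v u
    nlinarith
  have h2 : suppFun K u ≤ suppFun K v + R * ε := by
    have := hK.supp_sub u v
    rw [norm_sub_rev] at this
    nlinarith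
  have k1 := hK.supp_ge hu
  have k2 := hK.supp_ge hv
  have k3 := hL.supp_le_R hu
  have k4 := hL.supp_pos hu
  have hε : 0 ≤ ε := (norm_nonneg _).trans h
  have hku := hK.supp_pos hu
  have hkv := hK.supp_pos hv
  calc suppFun L v / suppFun K v ≤ (suppFun L u + R * ε) / suppFun K v := by gcongr
    _ = suppFun L u / suppFun K v + R * ε / suppFun K v := add_div _ _ _
    _ = suppFun L u / suppFun K u + suppFun L u * (suppFun K u - suppFun K v) / (suppFun K v * suppFun K u)
        + R * ε / suppFun K v := by field_simp; ring
    _ ≤ suppFun L u / suppFun K u + suppFun L u * (R * ε) / (suppFun K v * suppFun K u)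
        + R * ε / suppFun K v := by gcongr; linarith
    _ ≤ suppFun L u / suppFun K u + R * (R * ε) / (r * r) + R * ε / r := by gcongr
    _ = _ := by field_simp; ring

lemma bnd_pos (hK : Bod K r R) (hL : Bod L r R) {δ t : ℝ} (hδ : 0 ≤ δ) (ht : 0 < t) (ht1 : t < 1) {u : Eu n}
    (hu : ‖u‖ = 1) : 0 < 1 + t * bnd K L δ u := by
  have h1 := hK.supp_pos hu
  have h2 := hL.supp_pos hu
  have h3 : 0 < suppFun L u / suppFun K u := by positivity
  unfold bnd
  nlinarith [mul_pos ht h3, mul_nonneg ht.le hδ]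

lemma incl (hK : Bod K r R) (hL : Bod L r R) {N : ℕ} {ε : ℝ} (hε : 0 < ε) {u : Fin N → Eu n}
    (hu : ∀ i, ‖u i‖ = 1) (hcov : ∀ v : Eu n, ‖v‖ = 1 → ∃ i, ‖v - u i‖ ≤ ε)
    {t : ℝ} (ht : 0 < t) (ht1 : t < 1) {z : Eu n} (hz : z ∈ (1 - t) • K + t • L) (hz0 : z ≠ 0) :
    ∃ i, z ∈ (1 + t * bnd K L ((R / r + R ^ 2 / r ^ 2) * ε) (u i)) • cone (Dp K ε u i) := by
  have hr := hK.rpos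
  have hR := hK.Rnn
  obtain ⟨i, hi⟩ := Dp_union hK hcov (hK.proj_fr hz0)
  refine ⟨i, ?_⟩
  have hq := bnd_pos hK hL (δ := (R / r + R ^ 2 / r ^ 2) * ε) (by positivity) ht ht1 (hu i)
  set q := 1 + t * bnd K L ((R / r + R ^ 2 / r ^ 2) * ε) (u i) with hqd
  have hτ := hK.gauge_pos hz0
  obtain ⟨v, hv, hvu, hxv⟩ := (Dp_near ε u i).2 _ hi
  have hkv := hK.supp_pos hv
  rw [real_inner_smul_left, inv_mul_eq_iff_eq_mul₀ hτ.ne'] at hxv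
  have hzv : ⟪z, v⟫ ≤ (1 - t) * suppFun K v + t * suppFun L v := by
    obtain ⟨_, ⟨x, hx, rfl⟩, _, ⟨y, hy, rfl⟩, rfl⟩ := hz
    simp only [inner_add_left, real_inner_smul_left]
    have := hK.le_supp hx v
    have := hL.le_supp hy v
    have : 0 < 1 - t := by linarith
    gcongr
  have hle : gauge K z ≤ q := by
    have h1 : gauge K z ≤ (1 - t) + t * (suppFun L v / suppFun K v) := by
      rw [hxv] at hzv
      have : (1 - t) + t * (suppFun L v / suppFun K v) =
          ((1 - t) * suppFun K v + t * suppFun L v) / suppFun K v := by field_simp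
      rw [this, le_div_iff₀ hkv]; exact hzv
    have h2 := mul_le_mul_of_nonneg_left (ratio_var hK hL (hu i) hv hvu) ht.le
    rw [hqd, bnd]
    linarith
  refine ⟨(gauge K z / q) • ((gauge K z)⁻¹ • z), ⟨gauge K z / q, ⟨by positivity, ?_⟩, _, hi, rfl⟩, ?_⟩
  · rw [div_le_one hq]; exact hle
  · simp only [smul_smul]
    rw [show q * (gauge K z / q * (gauge K z)⁻¹) = 1 by field_simp, one_smul]

lemma gE_zero (hn : 2 ≤ n) : gE n {0} = 0 := by
  have : Nontrivial (Eu n) := Module.nontrivial_of_finrank_pos (R := ℝ) (by simp; omega)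
  rw [gE_eq]
  exact withDensity_absolutelyContinuous _ _ (measure_singleton _)

lemma var_ineq (hn : 2 ≤ n) (hK : Bod K r R) (hL : Bod L r R) {A : ℝ≥0} (hA : 1 < A)
    {c : ℝ} (H : ∀ (K : Set (Eu n)) (r R ε : ℝ), Bod K r R → ε * (R / r + 1) ≤ c → ∀ u : Eu n, ‖u‖ = 1 →
      ∀ F : Set (Eu n), MeasurableSet F → NearN K ε u F →
      volume (cone F) ≤ A * (kap n * ENNReal.ofReal (suppFun K u) * μH[(n:ℝ)-1] F) ∧
      kap n * ENNReal.ofReal (suppFun K u) * μH[(n:ℝ)-1] F ≤ A * volume (cone F))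
    {N : ℕ} {ε : ℝ} (hε : 0 < ε) (hεc : ε * (R / r + 1) ≤ c) {u : Fin N → Eu n}
    (hu : ∀ i, ‖u i‖ = 1) (hcov : ∀ v : Eu n, ‖v‖ = 1 → ∃ i, ‖v - u i‖ ≤ ε)
    {t : ℝ} (ht : 0 < t) (ht1 : t < 1) :
    (gE n).real ((1 - t) • K + t • L) - (gE n).real K ≤
      ∑ i, (((1 + t * bnd K L ((R / r + R ^ 2 / r ^ 2) * ε) (u i)) ^ n - 1) +
        ((A:ℝ) ^ 2 - 1) * |(1 + t * bnd K L ((R / r + R ^ 2 / r ^ 2) * ε) (u i)) ^ n - 1|) *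
        (kap n * suppFun K (u i) * Sm n (Dp K ε u i)) := by
  have hr := hK.rpos
  have hR := hK.Rnn
  have hs : (1 - t) • K + t • L ⊆ {0} ∪ ⋃ i,
      (1 + t * bnd K L ((R / r + R ^ 2 / r ^ 2) * ε) (u i)) • cone (Dp K ε u i) := by
    intro z hz
    by_cases h0 : z = 0
    · exact Or.inl h0
    · exact Or.inr (mem_iUnion.2 (incl hK hL hε hu hcov ht ht1 hz h0))
  have h1 : (gE n).real ((1 - t) • K + t • L) ≤ ∑ i, (gE n).real
      ((1 + t * bnd K L ((R / r + R ^ 2 / r ^ 2) * ε) (u i)) • cone (Dp K ε u i)) := by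
    refine (measureReal_mono hs).trans ((measureReal_union_le _ _).trans ?_)
    have : (gE n).real {0} = 0 := by rw [measureReal_def, gE_zero hn]; simp
    rw [this, zero_add]
    exact measureReal_iUnion_fintype_le _
  have h2 : ∑ i, (gE n).real (cone (Dp K ε u i)) ≤ (gE n).real K := by
    rw [← measureReal_iUnion_fintype (fun i j hij => cone_disj hK (Dp_fr _ _ _) (Dp_fr _ _ _) (Dp_disj ε u hij))
      (fun i => cone_meas hK (Dp_fr _ _ _) (Dp_meas hK _ _ _))]
    exact measureReal_mono (iUnion_subset fun i => cone_sub hK (Dp_fr _ _ _))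
  calc _ ≤ ∑ i, ((gE n).real
      ((1 + t * bnd K L ((R / r + R ^ 2 / r ^ 2) * ε) (u i)) • cone (Dp K ε u i)) -
        (gE n).real (cone (Dp K ε u i))) := by rw [Finset.sum_sub_distrib]; linarith
    _ ≤ _ := by
      refine Finset.sum_le_sum fun i _ => ?_
      refine shell_all hn hK hA (hu i) (Dp_fr _ _ _) (Dp_meas hK _ _ _) (fun F hF hFm => ?_)
        (bnd_pos hK hL (by positivity) ht ht1 (hu i))
      exact H K r R ε hK hεc (u i) (hu i) F hFm
        ⟨hF.trans (Dp_fr _ _ _), fun x hx => (Dp_near ε u i).2 x (hF hx)⟩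

lemma pow_deriv (n : ℕ) (b : ℝ) :
    Tendsto (fun t : ℝ => ((1 + t * b) ^ n - 1) / t) (𝓝[>] 0) (𝓝 (n * b)) := by
  have h : HasDerivAt (fun t : ℝ => (1 + t * b) ^ n) (n * b) 0 := by
    have := (((hasDerivAt_id (0:ℝ)).mul_const b).const_add 1).pow n
    exact HasDerivAt.congr_deriv this (by simp)
  have := h.tendsto_slope_zero_right
  simpa [div_eq_inv_mul] using this

lemma key1 (hn : 2 ≤ n) (hK : Bod K r R) (hL : Bod L r R) {A : ℝ≥0} (hA : 1 < A)
    {c : ℝ} (H : ∀ (K : Set (Eu n)) (r R ε : ℝ), Bod K r R → ε * (R / r + 1) ≤ c → ∀ u : Eu n, ‖u‖ = 1 →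
      ∀ F : Set (Eu n), MeasurableSet F → NearN K ε u F →
      volume (cone F) ≤ A * (kap n * ENNReal.ofReal (suppFun K u) * μH[(n:ℝ)-1] F) ∧
      kap n * ENNReal.ofReal (suppFun K u) * μH[(n:ℝ)-1] F ≤ A * volume (cone F))
    {N : ℕ} {ε : ℝ} (hε : 0 < ε) (hεc : ε * (R / r + 1) ≤ c) {u : Fin N → Eu n}
    (hu : ∀ i, ‖u i‖ = 1) (hcov : ∀ v : Eu n, ‖v‖ = 1 → ∃ i, ‖v - u i‖ ≤ ε) :
    gphi (PhiInv (gaussVol n K)) * (PhiInv (gaussVol n L) - PhiInv (gaussVol n K)) ≤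
      ∑ i, (n * bnd K L ((R / r + R ^ 2 / r ^ 2) * ε) (u i) +
        ((A:ℝ) ^ 2 - 1) * |n * bnd K L ((R / r + R ^ 2 / r ^ 2) * ε) (u i)|) *
        (kap n * suppFun K (u i) * Sm n (Dp K ε u i)) := by
  set a := PhiInv (gaussVol n K) with ha
  set b := PhiInv (gaussVol n L) with hb
  have hKm := hK.comp.isClosed.measurableSet
  have hPa : Phi a = (gE n).real K := by
    rw [ha, gaussVol_eq n hKm]; exact Phi_PhiInv (gE_mem hn hK.body)
  have t1 : Tendsto (fun t : ℝ => (Phi (a + t * (b - a)) - Phi a) / t) (𝓝[>] 0) (𝓝 (gphi a * (b - a))) := by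
    have h0 : HasDerivAt (fun t : ℝ => a + t * (b - a)) (b - a) 0 := by
      simpa using (((hasDerivAt_id (0:ℝ)).mul_const (b - a)).const_add a)
    have h : HasDerivAt (fun t : ℝ => Phi (a + t * (b - a))) (gphi a * (b - a)) 0 := by
      refine HasDerivAt.comp (h₂ := Phi) 0 ?_ h0
      simpa using Phi_hasDerivAt a
    simpa [div_eq_inv_mul] using h.tendsto_slope_zero_right
  have t2 : Tendsto (fun t : ℝ =>
      ∑ i, (((1 + t * bnd K L ((R / r + R ^ 2 / r ^ 2) * ε) (u i)) ^ n - 1) / t +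
        ((A:ℝ) ^ 2 - 1) * |((1 + t * bnd K L ((R / r + R ^ 2 / r ^ 2) * ε) (u i)) ^ n - 1) / t|) *
        (kap n * suppFun K (u i) * Sm n (Dp K ε u i))) (𝓝[>] 0)
      (𝓝 (∑ i, (n * bnd K L ((R / r + R ^ 2 / r ^ 2) * ε) (u i) +
        ((A:ℝ) ^ 2 - 1) * |n * bnd K L ((R / r + R ^ 2 / r ^ 2) * ε) (u i)|) *
        (kap n * suppFun K (u i) * Sm n (Dp K ε u i)))) := by
    refine tendsto_finsetSum _ fun i _ => ?_
    have := pow_deriv n (bnd K L ((R / r + R ^ 2 / r ^ 2) * ε) (u i))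
    exact (this.add (this.abs.const_mul _)).mul_const _
  refine le_of_tendsto_of_tendsto t1 t2 ?_
  filter_upwards [Ioo_mem_nhdsGT (zero_lt_one : (0:ℝ) < 1)] with t ht
  obtain ⟨ht, ht1⟩ := ht
  have hb1 : IsConvexBody ((1 - t) • K + t • L) := body_comb hK.body hL.body (by linarith)
  have e := ehrhard hn hK.body hL.body (l := 1 - t) (m := t) (by linarith) ht (by ring)
  rw [gaussVol_eq n hb1.2.1.isClosed.measurableSet] at e
  have e2 : Phi (a + t * (b - a)) ≤ (gE n).real ((1 - t) • K + t • L) := by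
    rw [← Phi_PhiInv (gE_mem hn hb1)]
    refine Phi_strictMono.monotone (le_trans (le_of_eq ?_) e)
    ring
  have e3 := var_ineq hn hK hL hA H hε hεc hu hcov ht ht1
  rw [hPa, div_le_iff₀ ht, Finset.sum_mul]
  refine (sub_le_sub_right e2 _).trans (e3.trans (le_of_eq (Finset.sum_congr rfl fun i _ => ?_)))
  rw [abs_div, abs_of_pos ht]
  field_simp

lemma Sm_sum (hn : 2 ≤ n) (hK : Bod K r R) {N : ℕ} (ε : ℝ) (u : Fin N → Eu n) :
    ∑ i, Sm n (Dp K ε u i) ≤ Sm n (frontier K) := by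
  have hf := fr_fin hn hK
  unfold Sm
  rw [← Finset.mul_sum, ← integral_iUnion_fintype (Dp_meas hK ε u) (Dp_disj ε u) fun j => exp_intOn
      ((measure_mono (Dp_fr _ _ _)).trans_lt hf)]
  refine mul_le_mul_of_nonneg_left ?_ (by positivity)
  exact setIntegral_mono_set (exp_intOn hf) (ae_of_all _ fun x => (Real.exp_pos _).le)
    (LE.le.eventuallyLE (iUnion_subset fun i => Dp_fr _ _ _))

lemma key2 (hn : 2 ≤ n) (hK : Bod K r R) (hL : Bod L r R) {e : ℝ} (he : 0 < e) :
    ∀ᶠ ε in 𝓝[>] (0:ℝ), ∀ (N : ℕ) (u : Fin N → Eu n), (∀ i, ‖u i‖ = 1) →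
      (∀ v : Eu n, ‖v‖ = 1 → ∃ i, ‖v - u i‖ ≤ ε) →
    gphi (PhiInv (gaussVol n K)) * (PhiInv (gaussVol n L) - PhiInv (gaussVol n K)) ≤
      ∑ i, (n * kap n) * (gaussSurf n K (etaP ε u i) * (suppFun L (u i) - suppFun K (u i))) + e := by
  have hr := hK.rpos
  have hR := hK.Rnn
  set S := Sm n (frontier K) with hS
  have hSn : 0 ≤ S := Sm_nonneg _ _
  set Q : ℝ := n * kap n * R * S with hQ
  obtain ⟨A0, hA1, hA0⟩ : ∃ A0 : ℝ, (A0 ^ 2 - 1) * (R / r + 2) * Q < e / 2 ∧ 1 < A0 := by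
    have : Continuous fun A0 : ℝ => (A0 ^ 2 - 1) * (R / r + 2) * Q := by fun_prop
    have h1 := (this.tendsto 1).mono_left (nhdsWithin_le_nhds (s := Ioi 1))
    simp only [one_pow, sub_self, zero_mul] at h1
    exact ((h1.eventually (gt_mem_nhds (by positivity : 0 < e / 2))).and self_mem_nhdsWithin).exists
  lift A0 to ℝ≥0 using by linarith with A hAe
  have hA : 1 < A := by exact_mod_cast hA0
  obtain ⟨c, hc, H⟩ := cone_comp hn hA
  have ev : ∀ (M d : ℝ), 0 < d → ∀ᶠ ε in 𝓝[>] (0:ℝ), M * ε < d := by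
    intro M d hd
    have : Continuous fun ε : ℝ => M * ε := by fun_prop
    have h1 := (this.tendsto 0).mono_left (nhdsWithin_le_nhds (s := Ioi 0))
    rw [mul_zero] at h1
    exact h1.eventually (gt_mem_nhds hd)
  filter_upwards [ev (R / r + 1) c hc, ev (R / r + R ^ 2 / r ^ 2) 1 one_pos,
    ev ((R / r + R ^ 2 / r ^ 2) * Q) (e / 2) (by positivity), self_mem_nhdsWithin]
    with ε h1 h2 h3 (hε : 0 < ε) N u hu hcov
  refine (key1 hn hK hL hA H hε (by linarith) hu hcov).trans ?_
  set δ := (R / r + R ^ 2 / r ^ 2) * ε with hδ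
  have hδ0 : 0 ≤ δ := by positivity
  have step : ∀ i, (n * bnd K L δ (u i) + ((A:ℝ) ^ 2 - 1) * |n * bnd K L δ (u i)|) *
        (kap n * suppFun K (u i) * Sm n (Dp K ε u i)) ≤
      (n * kap n) * (gaussSurf n K (etaP ε u i) * (suppFun L (u i) - suppFun K (u i))) +
        (n * kap n * R) * (δ + ((A:ℝ) ^ 2 - 1) * (R / r + 2)) * Sm n (Dp K ε u i) := by
    intro i
    rw [Dp_surf hn hK]
    have k1 := hK.supp_ge (hu i)
    have k2 := hK.supp_le_R (hu i)
    have k3 := hL.supp_le_R (hu i)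
    have k4 := hL.supp_pos (hu i)
    have k5 := hK.supp_pos (hu i)
    have hSi := Sm_nonneg n (Dp K ε u i)
    have hrat : suppFun L (u i) / suppFun K (u i) ≤ R / r := by gcongr
    have hrat0 : 0 < suppFun L (u i) / suppFun K (u i) := by positivity
    have hRr : 0 ≤ R / r := by positivity
    have hb : |bnd K L δ (u i)| ≤ R / r + 2 := by
      rw [bnd, abs_le]; constructor <;> linarith
    have hbe : suppFun K (u i) * bnd K L δ (u i) =
        suppFun L (u i) - suppFun K (u i) + suppFun K (u i) * δ := by
      rw [bnd]; field_simp
    have hA2 : 0 ≤ (A:ℝ) ^ 2 - 1 := by nlinarith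
    have hkn : (0:ℝ) ≤ kap n := NNReal.coe_nonneg _
    rw [abs_mul, abs_of_nonneg (Nat.cast_nonneg n : (0:ℝ) ≤ n)]
    calc _ = (n * kap n * Sm n (Dp K ε u i)) * (suppFun K (u i) * bnd K L δ (u i) +
          ((A:ℝ) ^ 2 - 1) * (suppFun K (u i) * |bnd K L δ (u i)|)) := by ring
      _ ≤ (n * kap n * Sm n (Dp K ε u i)) * (suppFun L (u i) - suppFun K (u i) + R * δ +
          ((A:ℝ) ^ 2 - 1) * (R * (R / r + 2))) := by rw [hbe]; gcongr
      _ = _ := by ring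
  refine (Finset.sum_le_sum fun i _ => step i).trans ?_
  rw [Finset.sum_add_distrib, ← Finset.mul_sum Finset.univ (fun i => Sm n (Dp K ε u i))]
  gcongr
  have hA2 : 0 ≤ (A:ℝ) ^ 2 - 1 := by nlinarith
  calc (n * kap n * R) * (δ + ((A:ℝ) ^ 2 - 1) * (R / r + 2)) * ∑ i, Sm n (Dp K ε u i)
      ≤ (n * kap n * R) * (δ + ((A:ℝ) ^ 2 - 1) * (R / r + 2)) * S := by
        gcongr
        exact Sm_sum hn hK ε u
    _ = (R / r + R ^ 2 / r ^ 2) * Q * ε + ((A:ℝ) ^ 2 - 1) * (R / r + 2) * Q := by rw [hδ, hQ]; ring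
    _ ≤ e := by linarith

lemma exists_Bod (hK : IsConvexBody K) (hL : IsConvexBody L) (hK0 : (0 : Eu n) ∈ interior K)
    (hL0 : (0 : Eu n) ∈ interior L) : ∃ r R, Bod K r R ∧ Bod L r R := by
  obtain ⟨r, hr, h⟩ := Metric.nhds_basis_closedBall.mem_iff.1
    (Filter.inter_mem (mem_interior_iff_mem_nhds.1 hK0) (mem_interior_iff_mem_nhds.1 hL0))
  obtain ⟨R, hR⟩ := (hK.2.1.union hL.2.1).isBounded.subset_closedBall (0 : Eu n)
  exact ⟨r, R, ⟨hK, hr, h.trans inter_subset_left, subset_union_left.trans hR⟩,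
    ⟨hL, hr, h.trans inter_subset_right, subset_union_right.trans hR⟩⟩

end

/-- Two convex bodies of Gaussian volume at least `1/2` with the same Gaussian surface
area measure have the same Gaussian volume. -/
theorem gaussian_minkowski_equal_volume
    (n : ℕ) (hn : 2 ≤ n) (K L : Set (Eu n))
    (hK : IsConvexBody K) (hL : IsConvexBody L)
    (hK0 : (0 : Eu n) ∈ interior K) (hL0 : (0 : Eu n) ∈ interior L)
    (heq : ∀ η ⊆ sphere (0 : Eu n) 1, MeasurableSet η → gaussSurf n K η = gaussSurf n L η)
    (hKvol : 1 / 2 ≤ gaussVol n K) (hLvol : 1 / 2 ≤ gaussVol n L) :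
    gaussVol n K = gaussVol n L := by
  obtain ⟨r, R, bK, bL⟩ := exists_Bod hK hL hK0 hL0
  have mK : gaussVol n K ∈ Ioo (0:ℝ) 1 := by
    rw [gaussVol_eq n hK.2.1.isClosed.measurableSet]; exact gE_mem hn hK
  have mL : gaussVol n L ∈ Ioo (0:ℝ) 1 := by
    rw [gaussVol_eq n hL.2.1.isClosed.measurableSet]; exact gE_mem hn hL
  have a0 : 0 ≤ PhiInv (gaussVol n K) := by
    rw [← Phi_strictMono.le_iff_le, Phi_PhiInv mK, Phi_zero]; exact hKvol
  have b0 : 0 ≤ PhiInv (gaussVol n L) := by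
    rw [← Phi_strictMono.le_iff_le, Phi_PhiInv mL, Phi_zero]; exact hLvol
  have key : ∀ e : ℝ, 0 < e →
      (gphi (PhiInv (gaussVol n K)) - gphi (PhiInv (gaussVol n L))) *
        (PhiInv (gaussVol n L) - PhiInv (gaussVol n K)) ≤ e + e := by
    intro e he
    obtain ⟨ε, ⟨h1, h2⟩, hε⟩ :=
      (((key2 hn bK bL he).and (key2 hn bL bK he)).and self_mem_nhdsWithin).exists
    obtain ⟨N, u, hu, hcov⟩ := exists_cover n (ε := ε) hε
    have k1 := h1 N u hu hcov
    have k2 := h2 N u hu hcov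
    have k3 : ∑ i, (n * kap n) * (gaussSurf n L (etaP ε u i) * (suppFun K (u i) - suppFun L (u i))) =
        - ∑ i, (n * kap n) * (gaussSurf n K (etaP ε u i) * (suppFun L (u i) - suppFun K (u i))) := by
      rw [← Finset.sum_neg_distrib]
      refine Finset.sum_congr rfl fun i _ => ?_
      rw [heq _ (etaP_sub ε u i) (etaP_meas ε u i)]
      ring
    rw [k3] at k2
    linarith
  have hle : (gphi (PhiInv (gaussVol n K)) - gphi (PhiInv (gaussVol n L))) *
      (PhiInv (gaussVol n L) - PhiInv (gaussVol n K)) ≤ 0 := by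
    refine le_of_forall_pos_le_add fun e he => ?_
    have := key (e / 2) (by positivity)
    linarith
  have hab : PhiInv (gaussVol n K) = PhiInv (gaussVol n L) := by
    rcases lt_trichotomy (PhiInv (gaussVol n K)) (PhiInv (gaussVol n L)) with h | h | h
    · have := mul_pos (sub_pos.2 (gphi_lt a0 h)) (sub_pos.2 h)
      linarith
    · exact h
    · have := mul_pos_of_neg_of_neg (sub_neg.2 (gphi_lt b0 h)) (sub_neg.2 h)
      linarith
  rw [← Phi_PhiInv mK, ← Phi_PhiInv mL, hab]
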